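/- Suppose I ⊆ K{y_1,…,y_n} is a pure binomial σ-ideal. Then ⟨I⟩_r : 𝔪 is a radical well-mixed σ-ideal which is finitely generated as a radical well-mixed σ-ideal, i.e., ⟨I⟩_r : 𝔪 = ⟨G⟩_r for some finite set G ⊆ ⟨I⟩_r : 𝔪. -/

import Mathlib

open Polynomial

section SigmaRing

variable {R : Type*} [CommRing R]

/-- A σ-ideal: an ideal closed under the difference operator σ. -/
def IsSigmaIdeal (σ : R →+* R) (I : Ideal R) : Prop := ∀ a ∈ I, σ a ∈ I

/-- A σ-ideal is well-mixed if `a * b ∈ I` implies `a * σ b ∈ I`. -/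
def IsWellMixed (σ : R →+* R) (I : Ideal R) : Prop := ∀ a b : R, a * b ∈ I → a * σ b ∈ I

/-- `[F]`, the smallest σ-ideal containing `F`. -/
def sigmaIdealGen (σ : R →+* R) (F : Set R) : Ideal R :=
  sInf {I : Ideal R | F ⊆ I ∧ IsSigmaIdeal σ I}

/-- `⟨F⟩`, the smallest well-mixed σ-ideal containing `F` (well-mixed closure). -/
def wmClosure (σ : R →+* R) (F : Set R) : Ideal R :=
  sInf {I : Ideal R | F ⊆ I ∧ IsSigmaIdeal σ I ∧ IsWellMixed σ I}

/-- `⟨F⟩_r`, the smallest radical well-mixed σ-ideal containing `F`. -/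
def rwmClosure (σ : R →+* R) (F : Set R) : Ideal R :=
  sInf {I : Ideal R | F ⊆ I ∧ IsSigmaIdeal σ I ∧ IsWellMixed σ I ∧ I.IsRadical}

/-- Symbolic exponent: for `p = Σ c_i x^i ∈ ℕ[x]`, `a^p = Π (σ^i a)^(c_i)`. -/
noncomputable def sexp (σ : R →+* R) (a : R) (p : Polynomial ℕ) : R :=
  ∏ i ∈ Finset.range (p.natDegree + 1), ((⇑σ)^[i] a) ^ (p.coeff i)

/-- `I` is finitely generated as a radical well-mixed σ-ideal. -/
def FinGenAsRWM (σ : R →+* R) (I : Ideal R) : Prop :=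
  ∃ G : Set R, G.Finite ∧ G ⊆ (I : Set R) ∧ I = rwmClosure σ G

/-- σ-prime: a reflexive σ-ideal which is prime. -/
def IsSigmaPrime (σ : R →+* R) (I : Ideal R) : Prop :=
  IsSigmaIdeal σ I ∧ (∀ a : R, σ a ∈ I → a ∈ I) ∧ I.IsPrime

end SigmaRing

/-- The σ-polynomial ring `K{y_1,…,y_n}`: polynomials in variables `y_i^{x^j}`,
indexed by pairs `(i, j) ∈ Fin n × ℕ`. -/
abbrev DPoly (K : Type*) [Field K] (n : ℕ) := MvPolynomial (Fin n × ℕ) K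

section DPoly

variable {K : Type*} [Field K] {n : ℕ} (σK : K →+* K)

/-- The difference operator on `K{y_1,…,y_n}` extending `σK`, with `σ(y_i^{x^j}) = y_i^{x^{j+1}}`. -/
noncomputable def shift : DPoly K n →+* DPoly K n :=
  MvPolynomial.eval₂Hom ((MvPolynomial.C : K →+* DPoly K n).comp σK)
    (fun v => MvPolynomial.X (v.1, v.2 + 1))

/-- `y_i^p` for `p ∈ ℕ[x]`. -/
noncomputable def ypow (i : Fin n) (p : Polynomial ℕ) : DPoly K n :=
  sexp (shift σK) (MvPolynomial.X (i, 0)) p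

/-- `y_i^{x^a}`. -/
noncomputable def varPow (i : Fin n) (a : ℕ) : DPoly K n :=
  ypow σK i (Polynomial.X ^ a)

/-- The monomial `Y^f = Π y_i^{f_i}` for `f ∈ ℕ[x]^n`. -/
noncomputable def monom (f : Fin n → Polynomial ℕ) : DPoly K n :=
  ∏ i, ypow σK i (f i)

/-- A pure binomial `Y^f − Y^g`. -/
def IsPureBinomial (p : DPoly K n) : Prop :=
  ∃ f g : Fin n → Polynomial ℕ, p = monom σK f - monom σK g

/-- A binomial `a·Y^f + b·Y^g` with `a, b ∈ K^×`. -/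
def IsBinomial (p : DPoly K n) : Prop :=
  ∃ (a b : K) (f g : Fin n → Polynomial ℕ), a ≠ 0 ∧ b ≠ 0 ∧
    p = MvPolynomial.C a * monom σK f + MvPolynomial.C b * monom σK g

/-- A pure binomial σ-ideal: a σ-ideal generated by pure binomials. -/
def IsPureBinomialSigmaIdeal (I : Ideal (DPoly K n)) : Prop :=
  ∃ S : Set (DPoly K n), (∀ p ∈ S, IsPureBinomial σK p) ∧ I = sigmaIdealGen (shift σK) S

/-- Positive part of `f ∈ ℤ[x]`. -/
noncomputable def posPart (f : Polynomial ℤ) : Polynomial ℕ :=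
  f.sum fun i c => Polynomial.monomial i c.toNat

/-- Negative part of `f ∈ ℤ[x]`. -/
noncomputable def negPart (f : Polynomial ℤ) : Polynomial ℕ :=
  f.sum fun i c => Polynomial.monomial i (-c).toNat

/-- The lattice σ-ideal `I_L = [Y^{f_+} − Y^{f_−} : f ∈ L]` of a ℤ[x]-lattice `L ⊆ ℤ[x]^n`. -/
noncomputable def latticeIdeal (L : Submodule (Polynomial ℤ) (Fin n → Polynomial ℤ)) :
    Ideal (DPoly K n) :=
  sigmaIdealGen (shift σK)
    {p | ∃ f ∈ L, p = monom σK (fun i => posPart (f i)) - monom σK (fun i => negPart (f i))}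

end DPoly

/-- `𝔪`: the multiplicatively closed set generated by the variables `y_i^{x^j}`. -/
def mSet (K : Type*) [Field K] (n : ℕ) : Set (DPoly K n) :=
  (Submonoid.closure (Set.range fun v : Fin n × ℕ => (MvPolynomial.X v : DPoly K n)) : Set _)

/-- `I : 𝔪 = {p : M p ∈ I for some M ∈ 𝔪}`. -/
def colonM {K : Type*} [Field K] {n : ℕ} (I : Ideal (DPoly K n)) : Set (DPoly K n) :=
  {p | ∃ M ∈ mSet K n, M * p ∈ I}

section Tsec

variable {K : Type*} [Field K] {n t : ℕ} (σK : K →+* K)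

/-- The set `T^{a_1…a_t}_{j_1…j_t}` of monomials `Y^f` with `deg f_{j_i} < a_i`. -/
def Tset (j : Fin t → Fin n) (a : Fin t → ℕ) : Set (DPoly K n) :=
  {p | ∃ f : Fin n → Polynomial ℕ,
    (∀ i : Fin t, (f (j i)).degree < (a i : WithBot ℕ)) ∧ p = monom σK f}

/-- `I` is saturated with respect to `{y_{j_1}^{x^{a_1}},…,y_{j_t}^{x^{a_t}}}`. -/
def SaturatedWrt (j : Fin t → Fin n) (a : Fin t → ℕ) (I : Ideal (DPoly K n)) : Prop :=
  ∀ g M : DPoly K n, M ∈ Tset σK j a → M * g ∈ I → g ∈ I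

/-- `J : T = {g : M g ∈ J for some M ∈ T}`. -/
def colonT (j : Fin t → Fin n) (a : Fin t → ℕ) (J : Ideal (DPoly K n)) : Set (DPoly K n) :=
  {g | ∃ M ∈ Tset σK j a, M * g ∈ J}

/-- The `T`-saturated closure `N^{a_1…a_t}_{j_1…j_t}(I)`: the smallest saturated σ-ideal
containing `I`. -/
noncomputable def Nclosure (j : Fin t → Fin n) (a : Fin t → ℕ) (I : Ideal (DPoly K n)) :
    Ideal (DPoly K n) :=
  sInf {J : Ideal (DPoly K n) | I ≤ J ∧ IsSigmaIdeal (shift σK) J ∧ SaturatedWrt σK j a J}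

/-- The set of variables `{y_{j_1}^{x^{a_1}},…,y_{j_t}^{x^{a_t}}}`. -/
noncomputable def varSet (j : Fin t → Fin n) (a : Fin t → ℕ) : Set (DPoly K n) :=
  Set.range fun i => varPow σK (j i) (a i)

/-- `⟨I₀ ∪ {y_{j_1}^{x^{a_1}},…,y_{j_t}^{x^{a_t}}}⟩_r` is quasi-normal. -/
def QuasiNormal (j : Fin t → Fin n) (a : Fin t → ℕ) (I0 : Ideal (DPoly K n)) : Prop :=
  SaturatedWrt σK j a I0 ∧
  ∀ f g : Fin n → Polynomial ℕ, monom σK f - monom σK g ∈ I0 →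
    monom σK f ∈ sigmaIdealGen (shift σK) (varSet σK j a) →
    monom σK g ∈ sigmaIdealGen (shift σK) (varSet σK j a)

end Tsec

/-- Compactness principle: a property `p B b` which is monotone in the finite set `B` and
which has a common finite `B` along every ultrafilter has a common finite `B` for all `b`. -/
theorem exists_finset_forall_of_ultrafilter {α β : Type*} (s : Set α) (p : Finset α → β → Prop)
    (mono : ∀ B B' b, B ⊆ B' → p B b → p B' b)
    (h : ∀ U : Ultrafilter β, ∃ B : Finset α, (B : Set α) ⊆ s ∧ ∀ᶠ b in (U : Filter β), p B b) :
    ∃ B : Finset α, (B : Set α) ⊆ s ∧ ∀ b, p B b := by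
  classical
  by_contra hcon
  let small : Set β → Prop := fun t => ∃ B : Finset α, (B : Set α) ⊆ s ∧ ∀ b ∈ t, p B b
  let f : Filter β := Filter.comk small ⟨∅, by simp, by simp⟩
    (fun t ⟨B, hB, ht⟩ u hu => ⟨B, hB, fun b hb => ht b (hu hb)⟩)
    (fun t ⟨B, hB, ht⟩ u ⟨B', hB', hu⟩ => ⟨B ∪ B', by
      rw [Finset.coe_union]; exact Set.union_subset hB hB', by
      rintro b (hb | hb)
      · exact mono B _ b Finset.subset_union_left (ht b hb)
      · exact mono B' _ b Finset.subset_union_right (hu b hb)⟩)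
  have hne : f.NeBot := by
    refine ⟨fun hbot => hcon ?_⟩
    have : (∅ : Set β) ∈ f := by rw [hbot]; trivial
    obtain ⟨B, hB, hb⟩ := (Filter.mem_comk.1 this : small _)
    exact ⟨B, hB, fun b => hb b (by simp)⟩
  obtain ⟨B, hB, hU⟩ := h (Ultrafilter.of f)
  have hmem : {b | p B b}ᶜ ∈ f := by
    refine Filter.mem_comk.2 ?_
    rw [compl_compl]
    exact ⟨B, hB, fun b hb => hb⟩
  have h1 := Ultrafilter.of_le f hmem
  have := Filter.inter_mem hU h1
  rw [show {b | p B b} ∩ {b | p B b}ᶜ = ∅ from Set.inter_compl_self _] at this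
  exact Ultrafilter.empty_notMem this

section ExponentModules

variable {n : ℕ}

theorem coeff_X_pow_smul (k : ℕ) (h : Fin n → ℤ[X]) (i : Fin n) (j : ℕ) :
    (((X : ℤ[X]) ^ k • h) i).coeff j = if k ≤ j then (h i).coeff (j - k) else 0 := by
  simp [coeff_X_pow_mul']

/-- Every term `x^j e_i` of `h` with `i ∈ F` satisfies `j < a i`. -/
def DegBelow (F : Finset (Fin n)) (a : Fin n → ℕ) (h : Fin n → ℤ[X]) : Prop :=
  ∀ i ∈ F, ∀ j, a i ≤ j → (h i).coeff j = 0

/-- The part of `h` in degrees at least `a`, in the components from `F`, is nonnegative and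
nonzero. -/
def PosAbove (F : Finset (Fin n)) (a : Fin n → ℕ) (h : Fin n → ℤ[X]) : Prop :=
  (∀ i ∈ F, ∀ j, a i ≤ j → 0 ≤ (h i).coeff j) ∧ ∃ i ∈ F, ∃ j, a i ≤ j ∧ 0 < (h i).coeff j

/-- The additive group generated by the shifts of elements of `B` bounded by `a` on `F`. -/
noncomputable def shiftSpan (B : Finset (Fin n → ℤ[X])) (F : Finset (Fin n)) (a : Fin n → ℕ) :
    AddSubgroup (Fin n → ℤ[X]) :=
  AddSubgroup.closure {v | ∃ g ∈ B, ∃ k : ℕ, v = (X : ℤ[X]) ^ k • g ∧ DegBelow F a v}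

theorem shiftSpan_mono {B B' : Finset (Fin n → ℤ[X])} (hB : B ⊆ B') (F : Finset (Fin n))
    (a : Fin n → ℕ) : shiftSpan B F a ≤ shiftSpan B' F a :=
  AddSubgroup.closure_mono fun _ ⟨g, hg, k, hk⟩ => ⟨g, hB hg, k, hk⟩

theorem exists_reduced_of_leading {O : Type*} [LinearOrder O] (κ : Fin n × ℕ → O)
    (hκ : Function.Injective κ) (w : Fin n × ℕ → Fin n → ℤ[X])
    (hw : ∀ v u : Fin n × ℕ, (w v u.1).coeff u.2 ≠ 0 → κ u ≤ κ v) (D : Finset (Fin n × ℕ)) :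
    (∀ v ∈ D, ∀ u, κ u ≤ κ v → u ∈ D) → ∀ h : Fin n → ℤ[X],
    (∀ u : Fin n × ℕ, (h u.1).coeff u.2 ≠ 0 → u ∈ D) →
    ∃ r : Fin n → ℤ[X], (∀ u : Fin n × ℕ, (r u.1).coeff u.2 ≠ 0 → u ∈ D) ∧
      h - r ∈ AddSubgroup.closure (w '' D) ∧
      ∀ v : Fin n × ℕ, (w v v.1).coeff v.2 ∣ (r v.1).coeff v.2 → (r v.1).coeff v.2 = 0 := by
  classical
  induction D using Finset.strongInduction with
  | H D ih =>
  intro hD h hh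
  rcases D.eq_empty_or_nonempty with rfl | hne
  · refine ⟨h, hh, by simp, fun v _ => ?_⟩
    by_contra hv
    simpa using hh v hv
  obtain ⟨v, hv, hmax⟩ := D.exists_max_image κ hne
  set m := (w v v.1).coeff v.2 with hm
  set c := (h v.1).coeff v.2 with hc
  let e : Fin n → ℤ[X] := Pi.single v.1 (monomial v.2 (c % m))
  have he : ∀ u : Fin n × ℕ, (e u.1).coeff u.2 = if u = v then c % m else 0 := by
    rintro ⟨i, j⟩
    rcases v with ⟨i', j'⟩
    by_cases hi : i = i'
    · subst hi
      by_cases hj : j = j'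
      · subst hj; simp [e]
      · simp [e, coeff_monomial, hj, Ne.symm hj]
    · simp [e, hi]
  let h' : Fin n → ℤ[X] := h - (c / m) • w v - e
  have hcoef : ∀ u : Fin n × ℕ, (h' u.1).coeff u.2 =
      (h u.1).coeff u.2 - (c / m) * (w v u.1).coeff u.2 - if u = v then c % m else 0 := by
    intro u
    rw [← he u]
    simp [h']
  obtain ⟨r, hr, hcl, hred⟩ := ih (D.erase v) (Finset.erase_ssubset hv) (by
      intro u hu t htu
      refine Finset.mem_erase.2 ⟨?_, hD u (Finset.mem_of_mem_erase hu) t htu⟩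
      rintro rfl
      exact (Finset.mem_erase.1 hu).1
        (hκ (le_antisymm (hmax u (Finset.mem_of_mem_erase hu)) htu))) h' (by
      intro u hu
      refine Finset.mem_erase.2 ⟨?_, ?_⟩
      · rintro rfl
        apply hu
        rw [hcoef, if_pos rfl, ← hm, ← hc]
        have := Int.emod_add_mul_ediv c m
        linarith [mul_comm m (c / m)]
      · by_contra huD
        apply hu
        have h1 : (h u.1).coeff u.2 = 0 := by by_contra hx; exact huD (hh u hx)
        have h2 : (w v u.1).coeff u.2 = 0 := by
          by_contra hx; exact huD (hD v hv u (hw v u hx))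
        rw [hcoef, h1, h2, if_neg (by rintro rfl; exact huD hv)]
        simp)
  have hrv : (r v.1).coeff v.2 = 0 := by
    by_contra hx
    exact (Finset.mem_erase.1 (hr v hx)).1 rfl
  refine ⟨r + e, ?_, ?_, ?_⟩
  · intro u hu
    by_cases huv : u = v
    · rw [huv]; exact hv
    · refine Finset.mem_of_mem_erase (hr u ?_)
      have := he u
      rw [if_neg huv] at this
      simpa [this] using hu
  · have : h - (r + e) = (h' - r) + (c / m) • w v := by simp only [h']; abel
    rw [this]
    refine add_mem (AddSubgroup.closure_mono (Set.image_mono ?_) hcl)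
      (zsmul_mem (AddSubgroup.subset_closure (Set.mem_image_of_mem w (Finset.mem_coe.2 hv))) _)
    exact Finset.coe_subset.2 (Finset.erase_subset v D)
  · intro u hdiv
    have hsum : ((r + e) u.1).coeff u.2 = (r u.1).coeff u.2 + if u = v then c % m else 0 := by
      rw [← he u]; simp
    rw [hsum] at hdiv ⊢
    by_cases huv : u = v
    · subst huv
      rw [hrv, if_pos rfl, zero_add] at hdiv ⊢
      rw [← hm] at hdiv
      have h1 : m ∣ c := by
        rw [← Int.emod_add_mul_ediv c m]
        exact dvd_add hdiv (dvd_mul_right _ _)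
      exact Int.emod_eq_zero_of_dvd h1
    · rw [if_neg huv, add_zero] at hdiv ⊢
      exact hred u hdiv

/-- The order on the terms `x^j e_i` by the value of `j - a i`, with ties broken by `i`. -/
def termKey (a : Fin n → ℕ) (v : Fin n × ℕ) : ℤ ×ₗ Fin n := toLex ((v.2 : ℤ) - a v.1, v.1)

theorem termKey_injective (a : Fin n → ℕ) : Function.Injective (termKey a) := by
  rintro ⟨i, j⟩ ⟨i', j'⟩ h
  have h' := Prod.ext_iff.1 (toLex.injective h)
  obtain ⟨h1, h2⟩ := h'
  dsimp only at h1 h2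
  subst h2
  simpa using h1

theorem termKey_add {a : Fin n → ℕ} {i i' : Fin n} {j j' : ℕ} (k : ℕ)
    (h : termKey a (i, j) ≤ termKey a (i', j')) :
    termKey a (i, j + k) ≤ termKey a (i', j' + k) := by
  simp only [termKey, Prod.Lex.toLex_le_toLex] at h ⊢
  push_cast
  rcases h with h | ⟨h, h'⟩
  · left; linarith
  · right; exact ⟨by linarith, h'⟩

theorem lt_of_termKey_le {a : Fin n → ℕ} {u v : Fin n × ℕ} (h : termKey a u ≤ termKey a v)
    (hv : v.2 < a v.1) : u.2 < a u.1 := by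
  simp only [termKey, Prod.Lex.toLex_le_toLex] at h
  zify at hv ⊢
  rcases h with h | ⟨h, -⟩ <;> linarith

/-- The leading coefficients at `x^j e_i` of elements of `L`, for the limit along `U` of the orders
`termKey a`. -/
def leadingIdeal (L : Submodule ℤ[X] (Fin n → ℤ[X])) (U : Ultrafilter (Fin n → ℕ)) (i : Fin n)
    (j : ℕ) : Ideal ℤ where
  carrier := {c | ∃ h ∈ L, (h i).coeff j = c ∧ ∀ᶠ a in (U : Filter (Fin n → ℕ)),
    ∀ u : Fin n × ℕ, (h u.1).coeff u.2 ≠ 0 → termKey a u ≤ termKey a (i, j)}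
  add_mem' := by
    rintro _ _ ⟨h, hL, rfl, hU⟩ ⟨h', hL', rfl, hU'⟩
    refine ⟨h + h', add_mem hL hL', by simp, ?_⟩
    filter_upwards [hU, hU'] with a ha ha' u hu
    by_cases h0 : (h u.1).coeff u.2 = 0
    · exact ha' u (by simpa [h0] using hu)
    · exact ha u h0
  zero_mem' := ⟨0, zero_mem _, by simp, by simp⟩
  smul_mem' := by
    rintro c _ ⟨h, hL, rfl, hU⟩
    refine ⟨(C c : ℤ[X]) • h, L.smul_mem _ hL, by simp, ?_⟩
    filter_upwards [hU] with a ha u hu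
    refine ha u fun h0 => hu ?_
    simp [h0]

theorem leadingIdeal_mono (L : Submodule ℤ[X] (Fin n → ℤ[X])) (U : Ultrafilter (Fin n → ℕ))
    (i : Fin n) : Monotone (leadingIdeal L U i) := by
  refine monotone_nat_of_le_succ fun j => ?_
  rintro _ ⟨h, hL, rfl, hU⟩
  refine ⟨(X : ℤ[X]) ^ 1 • h, L.smul_mem _ hL, by simp, ?_⟩
  filter_upwards [hU] with a ha
  rintro ⟨i', j'⟩ hu
  rw [coeff_X_pow_smul] at hu
  dsimp only at hu
  split_ifs at hu with hj
  · have := termKey_add 1 (ha (i', j' - 1) hu)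
    rwa [Nat.sub_add_cancel hj] at this
  · exact absurd rfl hu

theorem exists_eventually_max (U : Ultrafilter (Fin n → ℕ)) (D : Finset (Fin n × ℕ))
    (hD : D.Nonempty) :
    ∃ v ∈ D, ∀ᶠ a in (U : Filter (Fin n → ℕ)), ∀ u ∈ D, termKey a u ≤ termKey a v := by
  have h : ∀ᶠ a in (U : Filter (Fin n → ℕ)), ∃ v ∈ (D : Set (Fin n × ℕ)), ∀ u ∈ D,
      termKey a u ≤ termKey a v :=
    Filter.Eventually.of_forall fun a => by
      obtain ⟨v, hv, h⟩ := D.exists_max_image (termKey a) hD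
      exact ⟨v, hv, h⟩
  exact (Ultrafilter.eventually_exists_mem_iff D.finite_toSet).1 h

/-- The finite set of terms of `h`. -/
theorem finite_terms (h : Fin n → ℤ[X]) : {u : Fin n × ℕ | (h u.1).coeff u.2 ≠ 0}.Finite := by
  classical
  refine (Finset.finite_toSet ((Finset.univ : Finset (Fin n)).sigma
    fun i => (h i).support)).image (fun s => ((s.1, s.2) : Fin n × ℕ)) |>.subset ?_
  rintro ⟨i, j⟩ hu
  exact ⟨⟨i, j⟩, by simpa using hu, rfl⟩

theorem exists_shiftSpan_ultrafilter (L : Submodule ℤ[X] (Fin n → ℤ[X]))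
    (U : Ultrafilter (Fin n → ℕ)) :
    ∃ B : Finset (Fin n → ℤ[X]), (B : Set (Fin n → ℤ[X])) ⊆ L ∧
      ∀ᶠ a in (U : Filter (Fin n → ℕ)), ∀ h ∈ L, DegBelow Finset.univ a h →
        h ∈ shiftSpan B Finset.univ a := by
  classical
  have hstab : ∀ i, ∃ N, ∀ m, N ≤ m → leadingIdeal L U i N = leadingIdeal L U i m := fun i =>
    monotone_stabilizes_iff_noetherian.2 inferInstance ⟨leadingIdeal L U i, leadingIdeal_mono L U i⟩
  choose N hN using hstab
  have hgen : ∀ v : Fin n × ℕ, ∃ g ∈ L, leadingIdeal L U v.1 v.2 = Ideal.span {(g v.1).coeff v.2} ∧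
      ∀ᶠ a in (U : Filter (Fin n → ℕ)),
        ∀ u : Fin n × ℕ, (g u.1).coeff u.2 ≠ 0 → termKey a u ≤ termKey a v := by
    intro v
    obtain ⟨m, hm⟩ := (IsPrincipalIdealRing.principal (leadingIdeal L U v.1 v.2)).principal
    have : m ∈ leadingIdeal L U v.1 v.2 := by rw [hm]; exact Submodule.mem_span_singleton_self m
    obtain ⟨g, hg, rfl, hU⟩ := this
    exact ⟨g, hg, hm, hU⟩
  choose g hgL hgI hgU using hgen
  let I : Finset (Fin n × ℕ) := (Finset.univ ×ˢ Finset.range (Finset.univ.sup N + 1)).filter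
    fun v => v.2 ≤ N v.1
  have hI : ∀ v : Fin n × ℕ, v ∈ I ↔ v.2 ≤ N v.1 := by
    intro v
    simp only [I, Finset.mem_filter, Finset.mem_product, Finset.mem_univ, Finset.mem_range,
      true_and, and_iff_right_iff_imp]
    intro hv
    exact Nat.lt_succ_of_le (hv.trans (Finset.le_sup (f := N) (Finset.mem_univ v.1)))
  refine ⟨I.image g, ?_, ?_⟩
  · intro v hv
    obtain ⟨u, -, rfl⟩ := Finset.mem_image.1 (Finset.mem_coe.1 hv)
    exact hgL u
  have hev : ∀ᶠ a in (U : Filter (Fin n → ℕ)), ∀ v ∈ I, ∀ u : Fin n × ℕ,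
      (g v u.1).coeff u.2 ≠ 0 → termKey a u ≤ termKey a v :=
    (Filter.eventually_all_finset I).2 fun v _ => hgU v
  filter_upwards [hev] with a ha h hL hdeg
  let base : Fin n × ℕ → Fin n × ℕ := fun v => (v.1, min v.2 (N v.1))
  have hbase : ∀ v, base v ∈ I := fun v => (hI _).2 (min_le_right _ _)
  let w : Fin n × ℕ → Fin n → ℤ[X] := fun v => (X : ℤ[X]) ^ (v.2 - N v.1) • g (base v)
  have hbj : ∀ v : Fin n × ℕ, (base v).2 + (v.2 - N v.1) = v.2 := by
    intro v; simp only [base]; omega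
  have hw : ∀ v u : Fin n × ℕ, (w v u.1).coeff u.2 ≠ 0 → termKey a u ≤ termKey a v := by
    rintro ⟨i, j⟩ ⟨i', j'⟩ hu
    simp only [w] at hu
    rw [coeff_X_pow_smul] at hu
    split_ifs at hu with hj
    · have := termKey_add (j - N i) (ha _ (hbase (i, j)) (i', j' - (j - N i)) hu)
      rw [Nat.sub_add_cancel hj] at this
      rwa [show min j (N i) + (j - N i) = j by omega] at this
    · exact absurd rfl hu
  have hlead : ∀ v : Fin n × ℕ, leadingIdeal L U v.1 v.2 = Ideal.span {(w v v.1).coeff v.2} := by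
    rintro ⟨i, j⟩
    simp only [w]
    rw [coeff_X_pow_smul, if_pos (by omega), show j - (j - N i) = min j (N i) by omega]
    refine Eq.trans ?_ (hgI (base (i, j)))
    simp only [base]
    rcases le_total j (N i) with hj | hj
    · rw [min_eq_left hj]
    · rw [min_eq_right hj, hN i j hj]
  have hwL : ∀ v, w v ∈ L := fun v => L.smul_mem _ (hgL _)
  let D : Finset (Fin n × ℕ) := (Finset.univ ×ˢ Finset.range (Finset.univ.sup a)).filter
    fun v => v.2 < a v.1
  have hDmem : ∀ v : Fin n × ℕ, v ∈ D ↔ v.2 < a v.1 := by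
    intro v
    simp only [D, Finset.mem_filter, Finset.mem_product, Finset.mem_univ, Finset.mem_range,
      true_and, and_iff_right_iff_imp]
    intro hv
    exact hv.trans_le (Finset.le_sup (f := a) (Finset.mem_univ v.1))
  obtain ⟨r, hrD, hcl, hred⟩ := exists_reduced_of_leading (termKey a) (termKey_injective a) w hw D
    (fun v hv u hu => (hDmem u).2 (lt_of_termKey_le hu ((hDmem v).1 hv))) h (by
      intro u hu
      rw [hDmem]
      by_contra hlt
      exact hu (hdeg u.1 (Finset.mem_univ _) u.2 (not_lt.1 hlt)))
  have hsub : AddSubgroup.closure (w '' D) ≤ shiftSpan (I.image g) Finset.univ a := by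
    refine AddSubgroup.closure_mono ?_
    rintro _ ⟨v, hv, rfl⟩
    refine ⟨g (base v), Finset.mem_image_of_mem g (hbase v), _, rfl, ?_⟩
    intro i _ j hij
    by_contra hx
    have := lt_of_termKey_le (hw v (i, j) hx) ((hDmem v).1 hv)
    dsimp only at this
    omega
  have hclL : AddSubgroup.closure (w '' D) ≤ L.toAddSubgroup := by
    rw [AddSubgroup.closure_le]
    rintro _ ⟨v, -, rfl⟩
    exact hwL v
  have hrL : r ∈ L := by
    have := L.sub_mem hL (hclL hcl : h - r ∈ L)
    simpa using this
  have hr0 : r = 0 := by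
    by_contra hr0
    have hne : (finite_terms r).toFinset.Nonempty := by
      obtain ⟨i, hi⟩ := Function.ne_iff.1 hr0
      obtain ⟨j, hj⟩ : ∃ j, (r i).coeff j ≠ 0 := by
        by_contra hall
        push Not at hall
        exact hi (Polynomial.ext fun j => by simpa using hall j)
      exact ⟨(i, j), by simpa using hj⟩
    obtain ⟨v, hv, hmax⟩ := exists_eventually_max U _ hne
    have hv0 : (r v.1).coeff v.2 ≠ 0 := by simpa using hv
    have : (r v.1).coeff v.2 ∈ leadingIdeal L U v.1 v.2 := by
      refine ⟨r, hrL, rfl, ?_⟩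
      filter_upwards [hmax] with b hb u hu
      exact hb u (by simpa using hu)
    rw [hlead, Ideal.mem_span_singleton] at this
    exact hv0 (hred v this)
  rw [hr0, sub_zero] at hcl
  exact hsub hcl

/-- A submodule of `ℤ[x]^n` has a finite subset whose shifts generate, as a group, each of the
subgroups cut out by degree bounds. -/
theorem exists_shiftSpan (L : Submodule ℤ[X] (Fin n → ℤ[X])) :
    ∃ B : Finset (Fin n → ℤ[X]), (B : Set (Fin n → ℤ[X])) ⊆ L ∧
      ∀ (F : Finset (Fin n)) (a : Fin n → ℕ), ∀ h ∈ L, DegBelow F a h → h ∈ shiftSpan B F a := by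
  classical
  obtain ⟨B, hB, h⟩ := exists_finset_forall_of_ultrafilter (L : Set (Fin n → ℤ[X]))
    (fun B a => ∀ h ∈ L, DegBelow Finset.univ a h → h ∈ shiftSpan B Finset.univ a)
    (fun B B' a hBB' hp h hL hd => shiftSpan_mono hBB' _ _ (hp h hL hd))
    (exists_shiftSpan_ultrafilter L)
  refine ⟨B, hB, fun F a f hf hd => ?_⟩
  let b : Fin n → ℕ := fun i => if i ∈ F then a i else (f i).natDegree + 1
  refine AddSubgroup.closure_mono ?_ (h b f hf ?_)
  · rintro _ ⟨g, hg, k, rfl, hdeg⟩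
    refine ⟨g, hg, k, rfl, fun i hi j hj => hdeg i (Finset.mem_univ _) j ?_⟩
    simpa [b, hi] using hj
  · intro i _ j hj
    by_cases hi : i ∈ F
    · exact hd i hi j (by simpa [b, hi] using hj)
    · refine coeff_eq_zero_of_natDegree_lt ?_
      simp only [b, hi, if_false] at hj
      omega

end ExponentModules

theorem Ultrafilter.int_trichotomy {β : Type*} (U : Ultrafilter β) (f : β → ℤ) :
    (∃ d, ∀ᶠ b in (U : Filter β), f b = d) ∨ (∀ N : ℕ, ∀ᶠ b in (U : Filter β), (N : ℤ) < f b) ∨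
      ∀ N : ℕ, ∀ᶠ b in (U : Filter β), f b < -(N : ℤ) := by
  by_contra! hcon
  obtain ⟨h1, ⟨N, hN⟩, ⟨M, hM⟩⟩ := hcon
  have : ∀ᶠ b in (U : Filter β), ∃ d ∈ Set.Icc (-(M : ℤ)) N, f b = d := by
    filter_upwards [hN, hM] with b h2 h3
    exact ⟨f b, ⟨h3, h2⟩, rfl⟩
  obtain ⟨d, -, hd⟩ := (Ultrafilter.eventually_exists_mem_iff (Set.finite_Icc _ _)).1 this
  exact ((h1 d).and hd).exists.elim fun b hb => hb.1 hb.2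

section PositiveTails

variable {n : ℕ}

theorem exists_coeff_bound (B : Finset (Fin n → ℤ[X])) :
    ∃ C : ℕ, ∀ g ∈ B, ∀ i j, C ≤ j → (g i).coeff j = 0 := by
  refine ⟨B.sup (fun g => Finset.univ.sup fun i => (g i).natDegree) + 1, fun g hg i j hj => ?_⟩
  refine coeff_eq_zero_of_natDegree_lt (lt_of_le_of_lt ?_ (Nat.lt_of_succ_le hj))
  exact (Finset.le_sup (f := fun i => (g i).natDegree) (Finset.mem_univ i)).trans
    (Finset.le_sup (f := fun g : Fin n → ℤ[X] => Finset.univ.sup fun i => (g i).natDegree) hg)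

theorem exists_shift_down {L : Submodule ℤ[X] (Fin n → ℤ[X])} {B : Finset (Fin n → ℤ[X])}
    (hB : (B : Set (Fin n → ℤ[X])) ⊆ L) {C : ℕ} (hC : ∀ g ∈ B, ∀ i j, C ≤ j → (g i).coeff j = 0)
    {F : Finset (Fin n)} {a : Fin n → ℕ} {m : ℕ} (hm : ∀ i ∈ F, a i ≤ m) {h : Fin n → ℤ[X]}
    (hh : h ∈ shiftSpan B F a) :
    ∃ h' ∈ L, (∀ i ∈ F, h' i = 0) ∧ ∀ i j, C ≤ j → (h' i).coeff j = (h i).coeff (j + m) := by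
  induction hh using AddSubgroup.closure_induction with
  | mem v hv =>
    obtain ⟨g, hg, k, rfl, hdeg⟩ := hv
    rcases le_or_gt m k with hmk | hmk
    · have hcoef : ∀ i j, (((X : ℤ[X]) ^ (k - m) • g) i).coeff j =
          (((X : ℤ[X]) ^ k • g) i).coeff (j + m) := by
        intro i j
        rw [coeff_X_pow_smul, coeff_X_pow_smul]
        by_cases hj : k ≤ j + m
        · rw [if_pos hj, if_pos (by omega), show j - (k - m) = j + m - k by omega]
        · rw [if_neg hj, if_neg (by omega)]
      refine ⟨_, L.smul_mem _ (hB hg), fun i hi => ?_, fun i j _ => hcoef i j⟩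
      ext j
      rw [hcoef, hdeg i hi _ ((hm i hi).trans (Nat.le_add_left _ _)), coeff_zero]
    · refine ⟨0, zero_mem _, fun _ _ => rfl, fun i j hj => ?_⟩
      rw [coeff_X_pow_smul, if_pos (by omega), hC g hg _ _ (by omega)]
      simp
  | zero => exact ⟨0, zero_mem _, fun _ _ => rfl, by simp⟩
  | add x y _ _ hx hy =>
    obtain ⟨x', hx', hx0, hxc⟩ := hx
    obtain ⟨y', hy', hy0, hyc⟩ := hy
    refine ⟨x' + y', add_mem hx' hy', fun i hi => by simp [hx0 i hi, hy0 i hi], fun i j hj => ?_⟩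
    simp [hxc i j hj, hyc i j hj]
  | neg x _ hx =>
    obtain ⟨x', hx', hx0, hxc⟩ := hx
    refine ⟨-x', neg_mem hx', fun i hi => by simp [hx0 i hi], fun i j hj => ?_⟩
    simp [hxc i j hj]

theorem PosAbove.exists_min {F : Finset (Fin n)} {a : Fin n → ℕ} {h : Fin n → ℤ[X]}
    (hp : PosAbove F a h) : ∃ i₀ ∈ F, (∃ j, a i₀ ≤ j ∧ 0 < (h i₀).coeff j) ∧
      ∀ i ∈ F, a i < a i₀ → ∀ j, a i ≤ j → (h i).coeff j = 0 := by
  classical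
  obtain ⟨hnn, i, hi, hj⟩ := hp
  obtain ⟨i₀, hi₀, hmin⟩ := (F.filter fun i => ∃ j, a i ≤ j ∧ 0 < (h i).coeff j).exists_min_image a
    ⟨i, Finset.mem_filter.2 ⟨hi, hj⟩⟩
  obtain ⟨hi₀F, hj₀⟩ := Finset.mem_filter.1 hi₀
  refine ⟨i₀, hi₀F, hj₀, fun i hi hlt j hj => ?_⟩
  refine le_antisymm (not_lt.1 fun hpos => ?_) (hnn i hi j hj)
  exact (hmin i (Finset.mem_filter.2 ⟨hi, j, hj, hpos⟩)).not_gt hlt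

theorem exists_window (L : Submodule ℤ[X] (Fin n → ℤ[X]))
    (U : Ultrafilter (Fin n → ℕ)) (i₀ : Fin n) (low : Finset (Fin n))
    (hlow : ∀ i ∈ low, ∀ N : ℕ, ∀ᶠ a in (U : Filter (Fin n → ℕ)), (a i : ℤ) - a i₀ < -(N : ℤ)) :
    ∃ (C : ℕ) (m : (Fin n → ℕ) → ℕ) (e : Fin n → ℕ),
      (∀ᶠ a in (U : Filter (Fin n → ℕ)), m a ≤ a i₀) ∧
      (∀ i, (∃ d : ℤ, ∀ᶠ a in (U : Filter (Fin n → ℕ)), (a i : ℤ) - a i₀ = d) →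
        C ≤ e i ∧ ∀ᶠ a in (U : Filter (Fin n → ℕ)), a i = m a + e i) ∧
      ∀ᶠ a in (U : Filter (Fin n → ℕ)), ∀ h ∈ L, DegBelow low a h →
        ∃ h' ∈ L, (∀ i ∈ low, h' i = 0) ∧
          ∀ i j, C ≤ j → (h' i).coeff j = (h i).coeff (j + m a) := by
  have hd : ∀ i, ∃ d : ℤ, (∃ d : ℤ, ∀ᶠ a in (U : Filter (Fin n → ℕ)), (a i : ℤ) - a i₀ = d) →
      ∀ᶠ a in (U : Filter (Fin n → ℕ)), (a i : ℤ) - a i₀ = d := by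
    intro i
    by_cases h : ∃ d : ℤ, ∀ᶠ a in (U : Filter (Fin n → ℕ)), (a i : ℤ) - a i₀ = d
    · exact ⟨h.choose, fun _ => h.choose_spec⟩
    · exact ⟨0, fun h' => absurd h' h⟩
  choose d hd using hd
  rcases U.int_trichotomy (fun a => (a i₀ : ℤ)) with ⟨t, ht⟩ | hinf | hneg
  · refine ⟨0, fun _ => 0, fun i => (t + d i).toNat, by simp, fun i hi => ⟨Nat.zero_le _, ?_⟩, ?_⟩
    · filter_upwards [ht, hd i hi] with a h1 h2
      omega
    · have hempty : low = ∅ := by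
        refine Finset.eq_empty_of_forall_notMem fun i hi => ?_
        obtain ⟨a, h1, h2⟩ := (ht.and (hlow i hi t.toNat)).exists
        omega
      refine Filter.Eventually.of_forall fun a h hL _ => ⟨h, hL, ?_, by simp⟩
      simp [hempty]
  · obtain ⟨B, hB, hspan⟩ := exists_shiftSpan L
    obtain ⟨C, hC⟩ := exists_coeff_bound B
    let δ : ℕ := C + ∑ i, (d i).natAbs
    have hδ : ∀ i, (C : ℤ) ≤ δ + d i := by
      intro i
      have := Finset.single_le_sum (f := fun i => (d i).natAbs) (fun _ _ => Nat.zero_le _)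
        (Finset.mem_univ i)
      simp only [δ]
      omega
    refine ⟨C, fun a => a i₀ - δ, fun i => (δ + d i).toNat,
      Filter.Eventually.of_forall fun a => Nat.sub_le _ _, fun i hi => ⟨?_, ?_⟩, ?_⟩
    · have := hδ i
      dsimp only
      omega
    · filter_upwards [hd i hi, hinf δ] with a h1 h2
      have := hδ i
      omega
    · filter_upwards [(Filter.eventually_all_finset low).2 fun i hi => hlow i hi δ]
        with a ha h hL hdeg
      refine exists_shift_down hB hC (fun i hi => ?_) (hspan low a h hL hdeg)
      have := ha i hi
      omega
  · obtain ⟨a, ha⟩ := (hneg 0).exists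
    omega

theorem exists_posAbove_ultrafilter (L : Submodule ℤ[X] (Fin n → ℤ[X])) (F : Finset (Fin n))
    (U : Ultrafilter (Fin n → ℕ))
    (hbad : ∀ᶠ a in (U : Filter (Fin n → ℕ)), ∃ h ∈ L, PosAbove F a h) :
    ∃ g ∈ L, ∀ᶠ a in (U : Filter (Fin n → ℕ)), ∃ k : ℕ, PosAbove F a ((X : ℤ[X]) ^ k • g) := by
  classical
  have hbad' : ∀ᶠ a in (U : Filter (Fin n → ℕ)), ∃ i₀ ∈ (F : Set (Fin n)), ∃ h ∈ L,
      PosAbove F a h ∧ (∃ j, a i₀ ≤ j ∧ 0 < (h i₀).coeff j) ∧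
      ∀ i ∈ F, a i < a i₀ → ∀ j, a i ≤ j → (h i).coeff j = 0 := by
    filter_upwards [hbad] with a ⟨h, hL, hp⟩
    obtain ⟨i₀, hi₀, h1⟩ := hp.exists_min
    exact ⟨i₀, hi₀, h, hL, hp, h1⟩
  obtain ⟨i₀, hi₀, hev⟩ := (Ultrafilter.eventually_exists_mem_iff F.finite_toSet).1 hbad'
  let low : Finset (Fin n) := F.filter fun i =>
    ∀ N : ℕ, ∀ᶠ a in (U : Filter (Fin n → ℕ)), (a i : ℤ) - a i₀ < -(N : ℤ)
  have hlow : ∀ i ∈ low, ∀ N : ℕ, ∀ᶠ a in (U : Filter (Fin n → ℕ)),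
      (a i : ℤ) - a i₀ < -(N : ℤ) := fun i hi => (Finset.mem_filter.1 hi).2
  obtain ⟨C, m, e, hm, he, htr⟩ := exists_window L U i₀ low hlow
  let mid : Finset (Fin n) := F.filter fun i =>
    ∃ d : ℤ, ∀ᶠ a in (U : Filter (Fin n → ℕ)), (a i : ℤ) - a i₀ = d
  have hmid : ∀ i ∈ mid, C ≤ e i ∧ ∀ᶠ a in (U : Filter (Fin n → ℕ)), a i = m a + e i :=
    fun i hi => he i (Finset.mem_filter.1 hi).2
  have hmidev := (Filter.eventually_all_finset mid).2 fun i hi => (hmid i hi).2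
  have hi₀mid : i₀ ∈ mid := Finset.mem_filter.2 ⟨hi₀, 0, by simp⟩
  obtain ⟨a₀, ⟨h, hL, hp, ⟨j₀, hj₀, hpos⟩, hz⟩, htr₀, hmid₀, hlow₀⟩ := (hev.and (htr.and
    (hmidev.and ((Filter.eventually_all_finset low).2 fun i hi => hlow i hi 0)))).exists
  obtain ⟨h', hL', hzero, hcoef⟩ := htr₀ h hL (fun i hi j hj =>
    hz i (Finset.mem_filter.1 hi).1 (by have := hlow₀ i hi; omega) j hj)
  obtain ⟨D, hD⟩ := exists_coeff_bound {h'}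
  have hhigh : ∀ᶠ a in (U : Filter (Fin n → ℕ)), ∀ i ∈ F \ (low ∪ mid),
      (D : ℤ) < (a i : ℤ) - a i₀ := by
    refine (Filter.eventually_all_finset _).2 fun i hi => ?_
    simp only [low, mid, Finset.mem_sdiff, Finset.mem_union, Finset.mem_filter, not_or] at hi
    rcases U.int_trichotomy (fun a => (a i : ℤ) - a i₀) with h1 | h1 | h1
    · exact absurd ⟨hi.1, h1⟩ hi.2.2
    · exact h1 D
    · exact absurd ⟨hi.1, h1⟩ hi.2.1
  refine ⟨h', hL', ?_⟩
  filter_upwards [hm, hmidev, hhigh] with a ha hamid hahigh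
  refine ⟨m a, fun i hi j hj => ?_, i₀, hi₀, j₀ - m a₀ + m a, ?_, ?_⟩
  · rw [coeff_X_pow_smul]
    split_ifs with hmj
    · by_cases hil : i ∈ low
      · simp [hzero i hil]
      by_cases him : i ∈ mid
      · have h1 := hamid i him
        have h2 := hmid₀ i him
        have h3 := (hmid i him).1
        rw [hcoef i _ (by omega)]
        exact hp.1 i hi _ (by omega)
      · have := hahigh i (by simp [hi, hil, him])
        rw [hD h' (by simp) i _ (by omega)]
    · exact le_rfl
  · have h1 := hamid i₀ hi₀mid
    have h2 := hmid₀ i₀ hi₀mid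
    omega
  · have h2 := hmid₀ i₀ hi₀mid
    have h3 := (hmid i₀ hi₀mid).1
    rw [coeff_X_pow_smul, if_pos (by omega), hcoef i₀ _ (by omega)]
    rwa [show j₀ - m a₀ + m a - m a + m a₀ = j₀ by omega]

/-- A submodule of `ℤ[x]^n` has a finite subset whose shifts witness every occurrence of a
positive tail in the submodule. -/
theorem exists_posAbove (L : Submodule ℤ[X] (Fin n → ℤ[X])) :
    ∃ B : Finset (Fin n → ℤ[X]), (B : Set (Fin n → ℤ[X])) ⊆ L ∧
      ∀ (F : Finset (Fin n)) (a : Fin n → ℕ), (∃ h ∈ L, PosAbove F a h) →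
        ∃ g ∈ B, ∃ k : ℕ, PosAbove F a ((X : ℤ[X]) ^ k • g) := by
  classical
  have hF : ∀ F : Finset (Fin n), ∃ B : Finset (Fin n → ℤ[X]), (B : Set (Fin n → ℤ[X])) ⊆ L ∧
      ∀ a : Fin n → ℕ, (∃ h ∈ L, PosAbove F a h) →
        ∃ g ∈ B, ∃ k : ℕ, PosAbove F a ((X : ℤ[X]) ^ k • g) := by
    intro F
    refine exists_finset_forall_of_ultrafilter _ _ (fun B B' a hBB' hp h => ?_) fun U => ?_
    · obtain ⟨g, hg, hk⟩ := hp h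
      exact ⟨g, hBB' hg, hk⟩
    by_cases hbad : ∀ᶠ a in (U : Filter (Fin n → ℕ)), ∃ h ∈ L, PosAbove F a h
    · obtain ⟨g, hg, hev⟩ := exists_posAbove_ultrafilter L F U hbad
      refine ⟨{g}, by simpa using hg, ?_⟩
      filter_upwards [hev] with a ha _
      exact ⟨g, by simp, ha⟩
    · refine ⟨∅, by simp, ?_⟩
      filter_upwards [Ultrafilter.eventually_not.2 hbad] with a ha h
      exact absurd h ha
  choose B hB hp using hF
  refine ⟨Finset.univ.biUnion B, ?_, fun F a h => ?_⟩
  · intro g hg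
    obtain ⟨F, -, hg⟩ := Finset.mem_biUnion.1 (Finset.mem_coe.1 hg)
    exact hB F hg
  · obtain ⟨g, hg, hk⟩ := hp F a h
    exact ⟨g, Finset.mem_biUnion.2 ⟨F, Finset.mem_univ _, hg⟩, hk⟩

end PositiveTails

section Exponents

variable {n : ℕ}

/-- The vector in `ℤ[x]^n` with the exponents of a monomial as coefficients. -/
noncomputable def expVec : ((Fin n × ℕ) →₀ ℕ) →+ (Fin n → ℤ[X]) :=
  Finsupp.liftAddHom fun v => multiplesHom _ (Pi.single v.1 (X ^ v.2))

theorem expVec_single (v : Fin n × ℕ) (c : ℕ) :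
    expVec (Finsupp.single v c) = c • Pi.single v.1 ((X : ℤ[X]) ^ v.2) := by
  simp [expVec]

theorem coeff_expVec (d : (Fin n × ℕ) →₀ ℕ) (u : Fin n × ℕ) :
    (expVec d u.1).coeff u.2 = d u := by
  induction d using Finsupp.induction_linear with
  | zero => simp
  | add d d' h h' => simp [h, h']
  | single v c =>
    rw [expVec_single]
    obtain ⟨i, j⟩ := u
    obtain ⟨i', j'⟩ := v
    by_cases hi : i = i'
    · subst hi
      by_cases hj : j = j'
      · subst hj; simp
      · simp [coeff_X_pow, hj]
    · simp [hi]

theorem expVec_injective : Function.Injective (expVec (n := n)) := by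
  intro d d' h
  ext u
  have := coeff_expVec d u
  rw [h, coeff_expVec] at this
  exact_mod_cast this.symm

/-- The exponent of the positive part of a vector in `ℤ[x]^n`. -/
noncomputable def posExp (h : Fin n → ℤ[X]) : (Fin n × ℕ) →₀ ℕ :=
  Finsupp.ofSupportFinite (fun u => ((h u.1).coeff u.2).toNat) ((finite_terms h).subset (by
    intro u hu h0
    exact hu (by simp [h0])))

theorem posExp_apply (h : Fin n → ℤ[X]) (u : Fin n × ℕ) :
    posExp h u = ((h u.1).coeff u.2).toNat := rfl

theorem expVec_posExp_sub (h : Fin n → ℤ[X]) : expVec (posExp h) - expVec (posExp (-h)) = h := by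
  funext i
  ext j
  have h1 := coeff_expVec (posExp h) (i, j)
  have h2 := coeff_expVec (posExp (-h)) (i, j)
  simp only [posExp_apply, Pi.neg_apply, coeff_neg] at h1 h2
  rw [Pi.sub_apply, coeff_sub, h1, h2]
  omega

/-- The exponent of the image under the difference operator of a monomial. -/
noncomputable def shiftExp : ((Fin n × ℕ) →₀ ℕ) →+ ((Fin n × ℕ) →₀ ℕ) :=
  Finsupp.mapDomain.addMonoidHom fun v => (v.1, v.2 + 1)

theorem shiftExp_single (v : Fin n × ℕ) (c : ℕ) :
    shiftExp (Finsupp.single v c) = Finsupp.single (v.1, v.2 + 1) c := by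
  simp [shiftExp]

theorem expVec_shiftExp (d : (Fin n × ℕ) →₀ ℕ) : expVec (shiftExp d) = (X : ℤ[X]) • expVec d := by
  induction d using Finsupp.induction_linear with
  | zero => simp
  | add d d' h h' => simp [h, h']
  | single v c =>
    have h : Pi.single v.1 ((X : ℤ[X]) ^ (v.2 + 1)) =
        (X : ℤ[X]) • (Pi.single v.1 (X ^ v.2) : Fin n → ℤ[X]) := by
      rw [← Pi.single_smul, smul_eq_mul, pow_succ']
    rw [shiftExp_single, expVec_single, expVec_single, h, smul_comm]

theorem posExp_X_smul (h : Fin n → ℤ[X]) : posExp ((X : ℤ[X]) • h) = shiftExp (posExp h) := by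
  apply Finsupp.ext
  intro ⟨i, j⟩
  have h1 := coeff_expVec (shiftExp (posExp h)) (i, j)
  have h2 := coeff_expVec (posExp h) (i, j - 1)
  rw [expVec_shiftExp] at h1
  simp only [posExp_apply] at h2 ⊢
  cases j with
  | zero =>
    have h3 : (0 : ℤ) = shiftExp (posExp h) (i, 0) := by simpa using h1
    simpa using Int.natCast_inj.1 h3
  | succ j =>
    simp only [Pi.smul_apply, smul_eq_mul, coeff_X_mul] at h1 ⊢
    simp only [Nat.add_sub_cancel] at h2
    rw [h1] at h2
    omega

end Exponents

section Binomials

variable {K : Type*} [Field K] {n : ℕ}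

/-- The binomial with exponents `d` and `d'`. -/
noncomputable def binom (K : Type*) [Field K] {n : ℕ} (d d' : (Fin n × ℕ) →₀ ℕ) : DPoly K n :=
  MvPolynomial.monomial d 1 - MvPolynomial.monomial d' 1

theorem monomial_add_one (d d' : (Fin n × ℕ) →₀ ℕ) :
    (MvPolynomial.monomial (d + d') 1 : DPoly K n) =
      MvPolynomial.monomial d 1 * MvPolynomial.monomial d' 1 := by
  rw [MvPolynomial.monomial_mul, one_mul]

theorem shift_monomial (σK : K →+* K) (d : (Fin n × ℕ) →₀ ℕ) (c : K) :
    shift σK (MvPolynomial.monomial d c) = MvPolynomial.monomial (shiftExp d) (σK c) := by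
  rw [MvPolynomial.monomial_eq, MvPolynomial.monomial_eq, map_mul, shift,
    MvPolynomial.eval₂Hom_C, RingHom.comp_apply]
  congr 1
  rw [shiftExp, Finsupp.mapDomain.addMonoidHom_apply, Finsupp.prod_mapDomain_index (by simp)
    (fun _ _ _ => pow_add _ _ _), map_finsuppProd]
  simp

theorem shift_binom (σK : K →+* K) (d d' : (Fin n × ℕ) →₀ ℕ) :
    shift σK (binom K d d') = binom K (shiftExp d) (shiftExp d') := by
  simp [binom, shift_monomial]

theorem binom_add (p q p' q' : (Fin n × ℕ) →₀ ℕ) :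
    binom K (p + p') (q + q') = MvPolynomial.monomial p' 1 * binom K p q +
      MvPolynomial.monomial q 1 * binom K p' q' := by
  simp only [binom, monomial_add_one]
  ring

theorem monomial_mem_iff {P : Ideal (DPoly K n)} (hP : P.IsPrime) (d : (Fin n × ℕ) →₀ ℕ) :
    (MvPolynomial.monomial d 1 : DPoly K n) ∈ P ↔ ∃ v, d v ≠ 0 ∧ MvPolynomial.X v ∈ P := by
  rw [MvPolynomial.monomial_eq, map_one, one_mul, Finsupp.prod, hP.prod_mem_iff]
  constructor
  · rintro ⟨v, hv, hmem⟩
    exact ⟨v, Finsupp.mem_support_iff.1 hv, hP.mem_of_pow_mem _ hmem⟩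
  · rintro ⟨v, hv, hmem⟩
    exact ⟨v, Finsupp.mem_support_iff.2 hv, Ideal.pow_mem_of_mem _ hmem _ (Nat.pos_of_ne_zero hv)⟩

theorem binom_posExp_X_pow_smul_mem {σK : K →+* K} {P : Ideal (DPoly K n)}
    (hσ : IsSigmaIdeal (shift σK) P) {g : Fin n → ℤ[X]}
    (hg : binom K (posExp g) (posExp (-g)) ∈ P) (k : ℕ) :
    binom K (posExp ((X : ℤ[X]) ^ k • g)) (posExp (-((X : ℤ[X]) ^ k • g))) ∈ P := by
  induction k with
  | zero => simpa using hg
  | succ k ih =>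
    have := hσ _ ih
    rwa [shift_binom, ← posExp_X_smul, ← posExp_X_smul, smul_neg, smul_smul, ← pow_succ'] at this

theorem exists_variable_bounds {σK : K →+* K} {P : Ideal (DPoly K n)}
    (hσ : IsSigmaIdeal (shift σK) P) : ∃ (F : Finset (Fin n)) (a : Fin n → ℕ), ∀ i j,
      (MvPolynomial.X (i, j) : DPoly K n) ∈ P ↔ i ∈ F ∧ a i ≤ j := by
  classical
  refine ⟨Finset.univ.filter fun i => ∃ j, (MvPolynomial.X (i, j) : DPoly K n) ∈ P,
    fun i => if h : ∃ j, (MvPolynomial.X (i, j) : DPoly K n) ∈ P then Nat.find h else 0,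
    fun i j => ?_⟩
  constructor
  · intro h
    have h' : ∃ j, (MvPolynomial.X (i, j) : DPoly K n) ∈ P := ⟨j, h⟩
    simp only [Finset.mem_filter, Finset.mem_univ, true_and, dif_pos h']
    exact ⟨h', Nat.find_min' h' h⟩
  · simp only [Finset.mem_filter, Finset.mem_univ, true_and]
    rintro ⟨h, hle⟩
    rw [dif_pos h] at hle
    induction j, hle using Nat.le_induction with
    | base => exact Nat.find_spec h
    | succ j _ ih => simpa [shift] using hσ _ ih

theorem binom_mem_of_sub_eq {P : Ideal (DPoly K n)} (hP : P.IsPrime)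
    {d d' p q : (Fin n × ℕ) →₀ ℕ} (hq : (MvPolynomial.monomial q 1 : DPoly K n) ∉ P)
    (he : expVec p - expVec q = expVec d - expVec d') (hb : binom K p q ∈ P) :
    binom K d d' ∈ P := by
  have hdq : d + q = d' + p := by
    apply expVec_injective
    rw [map_add, map_add]
    rw [sub_eq_sub_iff_add_eq_add] at he
    rw [add_comm (expVec d'), he]
  refine (hP.mem_or_mem (x := MvPolynomial.monomial q 1) ?_).resolve_left hq
  have : MvPolynomial.monomial q 1 * binom K d d' = MvPolynomial.monomial d' 1 * binom K p q := by
    have h1 := congrArg (fun e => (MvPolynomial.monomial e 1 : DPoly K n)) hdq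
    simp only [monomial_add_one] at h1
    simp only [binom]
    linear_combination h1
  rw [this]
  exact P.mul_mem_left _ hb

theorem binom_mem_of_mem_shiftSpan {σK : K →+* K} {P : Ideal (DPoly K n)} (hP : P.IsPrime)
    (hσ : IsSigmaIdeal (shift σK) P) {F : Finset (Fin n)} {a : Fin n → ℕ}
    (hFa : ∀ i j, (MvPolynomial.X (i, j) : DPoly K n) ∈ P ↔ i ∈ F ∧ a i ≤ j)
    {B : Finset (Fin n → ℤ[X])} (hB : ∀ g ∈ B, binom K (posExp g) (posExp (-g)) ∈ P)
    {d d' : (Fin n × ℕ) →₀ ℕ} (h : expVec d - expVec d' ∈ shiftSpan B F a) :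
    binom K d d' ∈ P := by
  have key : ∀ h ∈ shiftSpan B F a, ∃ p q : (Fin n × ℕ) →₀ ℕ,
      (MvPolynomial.monomial p 1 : DPoly K n) ∉ P ∧ (MvPolynomial.monomial q 1 : DPoly K n) ∉ P ∧
      expVec p - expVec q = h ∧ binom K p q ∈ P := by
    intro h hh
    induction hh using AddSubgroup.closure_induction with
    | mem v hv =>
      obtain ⟨g, hg, k, rfl, hdeg⟩ := hv
      refine ⟨_, _, ?_, ?_, expVec_posExp_sub _, binom_posExp_X_pow_smul_mem hσ (hB g hg) k⟩
      all_goals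
        rw [monomial_mem_iff hP]
        rintro ⟨⟨i, j⟩, h1, h2⟩
        obtain ⟨hi, hj⟩ := (hFa i j).1 h2
        have := hdeg i hi j hj
        simp [posExp_apply, -Pi.smul_apply, this] at h1
    | zero =>
      refine ⟨0, 0, ?_, ?_, by simp, by simp [binom]⟩ <;>
        exact fun h => hP.one_notMem h
    | add x y _ _ hx hy =>
      obtain ⟨p, q, hp, hq, hx, hb⟩ := hx
      obtain ⟨p', q', hp', hq', hy, hb'⟩ := hy
      refine ⟨p + p', q + q', ?_, ?_, ?_, ?_⟩
      · rw [monomial_add_one]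
        exact fun h => (hP.mem_or_mem h).elim hp hp'
      · rw [monomial_add_one]
        exact fun h => (hP.mem_or_mem h).elim hq hq'
      · rw [← hx, ← hy, map_add, map_add]; abel
      · rw [binom_add]
        exact add_mem (P.mul_mem_left _ hb) (P.mul_mem_left _ hb')
    | neg x _ hx =>
      obtain ⟨p, q, hp, hq, hx, hb⟩ := hx
      refine ⟨q, p, hq, hp, by rw [← hx]; abel, ?_⟩
      have := neg_mem hb
      simpa [binom] using this
  obtain ⟨p, q, -, hq, he, hb⟩ := key _ h
  exact binom_mem_of_sub_eq hP hq he hb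

theorem not_posAbove_of_binom_mem {P : Ideal (DPoly K n)} (hP : P.IsPrime)
    {F : Finset (Fin n)} {a : Fin n → ℕ}
    (hFa : ∀ i j, (MvPolynomial.X (i, j) : DPoly K n) ∈ P ↔ i ∈ F ∧ a i ≤ j) {g : Fin n → ℤ[X]}
    (hg : binom K (posExp g) (posExp (-g)) ∈ P) : ¬ PosAbove F a g := by
  rintro ⟨hnn, i, hi, j, hj, hpos⟩
  have h1 : (MvPolynomial.monomial (posExp g) 1 : DPoly K n) ∈ P :=
    (monomial_mem_iff hP _).2 ⟨(i, j), by simp [posExp_apply, hpos], (hFa i j).2 ⟨hi, hj⟩⟩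
  have h2 := (Submodule.sub_mem_iff_right P h1).1 hg
  obtain ⟨⟨i', j'⟩, h3, h4⟩ := (monomial_mem_iff hP _).1 h2
  obtain ⟨hi', hj'⟩ := (hFa i' j').1 h4
  have := hnn i' hi' j' hj'
  simp only [posExp_apply, Pi.neg_apply, coeff_neg] at h3
  omega

/-- Finitely many binomials from a lattice force all its binomials to lie in a prime σ-ideal. -/
theorem exists_finset_binom_mem_prime (σK : K →+* K) (L : Submodule ℤ[X] (Fin n → ℤ[X])) :
    ∃ B : Finset (Fin n → ℤ[X]), (B : Set (Fin n → ℤ[X])) ⊆ L ∧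
      ∀ P : Ideal (DPoly K n), P.IsPrime → IsSigmaIdeal (shift σK) P →
        (∀ g ∈ B, binom K (posExp g) (posExp (-g)) ∈ P) →
        ∀ d d', expVec d - expVec d' ∈ L → binom K d d' ∈ P := by
  classical
  obtain ⟨B, hB, hspan⟩ := exists_shiftSpan L
  obtain ⟨B', hB', hpos⟩ := exists_posAbove L
  refine ⟨B ∪ B', by simp [hB, hB'], fun P hP hσ hmem d d' hdd => ?_⟩
  obtain ⟨F, a, hFa⟩ := exists_variable_bounds hσ
  have hno : ∀ h ∈ L, ¬ PosAbove F a h := by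
    intro h hL hp
    obtain ⟨g, hg, k, hk⟩ := hpos F a ⟨h, hL, hp⟩
    exact not_posAbove_of_binom_mem hP hFa
      (binom_posExp_X_pow_smul_mem hσ (hmem g (Finset.mem_union_right _ hg)) k) hk
  set h := expVec d - expVec d' with hh
  by_cases hdeg : DegBelow F a h
  · exact binom_mem_of_mem_shiftSpan hP hσ hFa (fun g hg => hmem g (Finset.mem_union_left _ hg))
      (hspan F a _ hdd hdeg)
  have hco : ∀ i j, (h i).coeff j = (d (i, j) : ℤ) - d' (i, j) := by
    intro i j
    rw [hh, Pi.sub_apply, coeff_sub, coeff_expVec d (i, j), coeff_expVec d' (i, j)]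
  have two : ∀ f ∈ L, (∃ i ∈ F, ∃ j, a i ≤ j ∧ 0 < (f i).coeff j) →
      ∃ i ∈ F, ∃ j, a i ≤ j ∧ (f i).coeff j < 0 := by
    intro f hf hex
    by_contra! hcon
    exact hno f hf ⟨hcon, hex⟩
  have hboth : (∃ i ∈ F, ∃ j, a i ≤ j ∧ 0 < (h i).coeff j) ∧
      ∃ i ∈ F, ∃ j, a i ≤ j ∧ (h i).coeff j < 0 := by
    simp only [DegBelow, not_forall] at hdeg
    obtain ⟨i, hi, j, hj, hne⟩ := hdeg
    rcases lt_or_gt_of_ne hne with hlt | hgt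
    · obtain ⟨i', hi', j', hj', hlt'⟩ := two (-h) (neg_mem hdd) ⟨i, hi, j, hj, by simpa using hlt⟩
      exact ⟨⟨i', hi', j', hj', by simpa using hlt'⟩, i, hi, j, hj, hlt⟩
    · exact ⟨⟨i, hi, j, hj, hgt⟩, two h hdd ⟨i, hi, j, hj, hgt⟩⟩
  obtain ⟨⟨i, hi, j, hj, h1⟩, i', hi', j', hj', h2⟩ := hboth
  rw [hco] at h1 h2
  refine sub_mem ((monomial_mem_iff hP _).2 ⟨(i, j), by omega, (hFa i j).2 ⟨hi, hj⟩⟩)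
    ((monomial_mem_iff hP _).2 ⟨(i', j'), by omega, (hFa i' j').2 ⟨hi', hj'⟩⟩)

end Binomials

section RadicalWellMixed

variable {R : Type*} [CommRing R] {σ : R →+* R}

theorem subset_rwmClosure (F : Set R) : F ⊆ rwmClosure σ F :=
  fun _ hx => Submodule.mem_sInf.2 fun _ hJ => hJ.1 hx

theorem rwmClosure_le {F : Set R} {J : Ideal R} (hF : F ⊆ J) (hσ : IsSigmaIdeal σ J)
    (hw : IsWellMixed σ J) (hr : J.IsRadical) : rwmClosure σ F ≤ J :=
  sInf_le ⟨hF, hσ, hw, hr⟩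

theorem isSigmaIdeal_rwmClosure (F : Set R) : IsSigmaIdeal σ (rwmClosure σ F) :=
  fun a ha => Submodule.mem_sInf.2 fun J hJ => hJ.2.1 a (Submodule.mem_sInf.1 ha J hJ)

theorem isWellMixed_rwmClosure (F : Set R) : IsWellMixed σ (rwmClosure σ F) :=
  fun a b hab => Submodule.mem_sInf.2 fun J hJ => hJ.2.2.1 a b (Submodule.mem_sInf.1 hab J hJ)

theorem isRadical_rwmClosure (F : Set R) : (rwmClosure σ F).IsRadical := by
  rintro a ⟨k, hk⟩
  exact Submodule.mem_sInf.2 fun J hJ => hJ.2.2.2 ⟨k, Submodule.mem_sInf.1 hk J hJ⟩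

theorem IsSigmaIdeal.isWellMixed_of_isPrime {P : Ideal R} (hσ : IsSigmaIdeal σ P)
    (hP : P.IsPrime) : IsWellMixed σ P := fun _ b hab =>
  (hP.mem_or_mem hab).elim (fun ha => P.mul_mem_right _ ha) fun hb => P.mul_mem_left _ (hσ b hb)

theorem sigmaIdealGen_le {F : Set R} {J : Ideal R} (hF : F ⊆ J) (hσ : IsSigmaIdeal σ J) :
    sigmaIdealGen σ F ≤ J :=
  sInf_le ⟨hF, hσ⟩

theorem exists_notMem_mul_mem_of_mem_minimalPrimes {I P : Ideal R} (hI : I.IsRadical)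
    (hP : P ∈ I.minimalPrimes) {x : R} (hx : x ∈ P) : ∃ y ∉ P, y * x ∈ I := by
  obtain ⟨⟨hp₁, hp₂⟩, hp₃⟩ := hP
  have : P.map (algebraMap R (Localization.AtPrime P)) ≤ (I.map (algebraMap _ _)).radical := by
    rw [Ideal.radical_eq_sInf, le_sInf_iff]
    rintro q ⟨hq', hq⟩
    obtain ⟨h₁, h₂⟩ := ((IsLocalization.AtPrime.orderIsoOfPrime _ P) ⟨q, hq⟩).2
    rw [Ideal.map_le_iff_le_comap] at hq' ⊢
    exact hp₃ ⟨h₁, hq'⟩ h₂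
  obtain ⟨k, hk⟩ := this (Ideal.mem_map_of_mem _ hx)
  rw [IsLocalization.mem_map_algebraMap_iff (M := P.primeCompl)] at hk
  obtain ⟨⟨a, b⟩, hk⟩ := hk
  rw [← map_pow, ← map_mul, IsLocalization.eq_iff_exists P.primeCompl] at hk
  obtain ⟨t, ht⟩ := hk
  refine ⟨t * b, (t * b).2, hI ⟨k + 1, ?_⟩⟩
  simp only at ht
  have : (t.1 * b.1 * x) ^ (k + 1) = (t.1 ^ k * b.1 ^ k * x * t.1) * a := by
    rw [mul_assoc _ _ a.1, ← ht]; ring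
  rw [this]
  exact I.mul_mem_left _ a.2

theorem isSigmaIdeal_of_mem_minimalPrimes {I P : Ideal R} (hw : IsWellMixed σ I)
    (hr : I.IsRadical) (hP : P ∈ I.minimalPrimes) : IsSigmaIdeal σ P := by
  intro x hx
  obtain ⟨y, hy, hyx⟩ := exists_notMem_mul_mem_of_mem_minimalPrimes hr hP hx
  exact (hP.1.1.mem_or_mem (hP.1.2 (hw y x hyx))).resolve_left hy

end RadicalWellMixed

section Colon

variable {K : Type*} [Field K] {n : ℕ}

theorem mul_mem_mSet {M N : DPoly K n} (hM : M ∈ mSet K n) (hN : N ∈ mSet K n) :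
    M * N ∈ mSet K n :=
  Submonoid.mul_mem _ hM hN

theorem X_mem_mSet (v : Fin n × ℕ) : (MvPolynomial.X v : DPoly K n) ∈ mSet K n :=
  Submonoid.subset_closure ⟨v, rfl⟩

theorem shift_mem_mSet (σK : K →+* K) {M : DPoly K n} (hM : M ∈ mSet K n) :
    shift σK M ∈ mSet K n := by
  have : (Submonoid.closure (Set.range fun v : Fin n × ℕ => (MvPolynomial.X v : DPoly K n))) ≤
      (Submonoid.closure (Set.range fun v : Fin n × ℕ => (MvPolynomial.X v : DPoly K n))).comap
        (shift σK) := by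
    rw [Submonoid.closure_le]
    rintro _ ⟨v, rfl⟩
    have := X_mem_mSet (K := K) (v.1, v.2 + 1)
    rw [Submonoid.coe_comap, Set.mem_preimage]
    simpa [shift, mSet] using this
  exact this hM

theorem notMem_of_mem_mSet {P : Ideal (DPoly K n)} (hP : P.IsPrime)
    (hX : ∀ v, (MvPolynomial.X v : DPoly K n) ∉ P) {M : DPoly K n} (hM : M ∈ mSet K n) : M ∉ P := by
  have : (Submonoid.closure (Set.range fun v : Fin n × ℕ => (MvPolynomial.X v : DPoly K n))) ≤
      P.primeCompl := by
    rw [Submonoid.closure_le]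
    rintro _ ⟨v, rfl⟩
    exact hX v
  exact this hM

/-- The colon `A : 𝔪` as an ideal. -/
def colonIdeal (A : Ideal (DPoly K n)) : Ideal (DPoly K n) where
  carrier := colonM A
  add_mem' := by
    rintro p q ⟨M, hM, hp⟩ ⟨N, hN, hq⟩
    refine ⟨M * N, mul_mem_mSet hM hN, ?_⟩
    rw [show M * N * (p + q) = N * (M * p) + M * (N * q) by ring]
    exact add_mem (A.mul_mem_left _ hp) (A.mul_mem_left _ hq)
  zero_mem' := ⟨1, Submonoid.one_mem _, by simp⟩
  smul_mem' := by
    rintro c p ⟨M, hM, hp⟩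
    refine ⟨M, hM, ?_⟩
    rw [smul_eq_mul, mul_left_comm]
    exact A.mul_mem_left _ hp

theorem colonIdeal_le {A P : Ideal (DPoly K n)} (hAP : A ≤ P) (hP : P.IsPrime)
    (hX : ∀ v, (MvPolynomial.X v : DPoly K n) ∉ P) : colonIdeal A ≤ P := by
  rintro p ⟨M, hM, hp⟩
  exact (hP.mem_or_mem (hAP hp)).resolve_left (notMem_of_mem_mSet hP hX hM)

theorem isSigmaIdeal_colonIdeal {σK : K →+* K} {A : Ideal (DPoly K n)}
    (hA : IsSigmaIdeal (shift σK) A) : IsSigmaIdeal (shift σK) (colonIdeal A) := by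
  rintro p ⟨M, hM, hp⟩
  exact ⟨_, shift_mem_mSet σK hM, by rw [← map_mul]; exact hA _ hp⟩

theorem isWellMixed_colonIdeal {σK : K →+* K} {A : Ideal (DPoly K n)}
    (hA : IsWellMixed (shift σK) A) : IsWellMixed (shift σK) (colonIdeal A) := by
  rintro a b ⟨M, hM, hp⟩
  exact ⟨M, hM, by rw [← mul_assoc] at hp ⊢; exact hA _ _ hp⟩

theorem isRadical_colonIdeal {A : Ideal (DPoly K n)} (hA : A.IsRadical) :
    (colonIdeal A).IsRadical := by
  rintro p ⟨k, M, hM, hp⟩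
  refine ⟨M, hM, hA ⟨k + 1, ?_⟩⟩
  rw [show (M * p) ^ (k + 1) = M ^ k * p * (M * p ^ k) by ring]
  exact A.mul_mem_left _ hp

theorem X_notMem_of_mem_minimalPrimes_colonIdeal {A P : Ideal (DPoly K n)} (hA : A.IsRadical)
    (hP : P ∈ (colonIdeal A).minimalPrimes) (v : Fin n × ℕ) :
    (MvPolynomial.X v : DPoly K n) ∉ P := by
  intro hv
  obtain ⟨y, hy, M, hM, hmem⟩ :=
    exists_notMem_mul_mem_of_mem_minimalPrimes (isRadical_colonIdeal hA) hP hv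
  refine hy (hP.1.2 ⟨M * MvPolynomial.X v, mul_mem_mSet hM (X_mem_mSet v), ?_⟩)
  rwa [mul_assoc, mul_comm (MvPolynomial.X v)]

end Colon

section BinomialSpans

variable {K : Type*} [Field K] {n : ℕ}

theorem mem_span_binom_of_fiber_sums {T : Type*} [DecidableEq T]
    (ψ : ((Fin n × ℕ) →₀ ℕ) → T) (p : DPoly K n)
    (hp : ∀ t, ∑ d ∈ p.support with ψ d = t, p.coeff d = 0) :
    p ∈ Ideal.span {q : DPoly K n | ∃ d d', ψ d = ψ d' ∧ q = binom K d d'} := by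
  classical
  let r : ((Fin n × ℕ) →₀ ℕ) → ((Fin n × ℕ) →₀ ℕ) := fun d => Function.invFun ψ (ψ d)
  have hr : ∀ d, ψ (r d) = ψ d := fun d => Function.invFun_eq ⟨d, rfl⟩
  have h0 : ∑ d ∈ p.support, MvPolynomial.monomial (r d) (p.coeff d) = 0 := by
    rw [← Finset.sum_fiberwise_of_maps_to (t := p.support.image ψ)
      (fun d hd => Finset.mem_image_of_mem ψ hd)]
    refine Finset.sum_eq_zero fun t _ => ?_
    have : ∀ d ∈ p.support.filter (fun d => ψ d = t),
        MvPolynomial.monomial (r d) (p.coeff d) =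
          MvPolynomial.monomial (Function.invFun ψ t) (p.coeff d) := by
      intro d hd
      rw [← (Finset.mem_filter.1 hd).2]
    rw [Finset.sum_congr rfl this, ← map_sum, hp t, map_zero]
  have hsum : p = ∑ d ∈ p.support, MvPolynomial.C (p.coeff d) * binom K d (r d) := by
    conv_lhs => rw [p.as_sum, ← sub_zero (Finset.sum _ _), ← h0, ← Finset.sum_sub_distrib]
    refine Finset.sum_congr rfl fun d _ => ?_
    rw [binom, mul_sub, MvPolynomial.C_mul_monomial, MvPolynomial.C_mul_monomial, mul_one]
  rw [hsum]
  exact sum_mem fun d _ => Ideal.mul_mem_left _ _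
    (Ideal.subset_span ⟨d, r d, (hr d).symm, rfl⟩)

theorem mem_span_binom_of_power_sums {E : Type*} [CommRing E] [IsDomain E] (φ : DPoly K n →+* E)
    (p : DPoly K n) (hp : ∀ i : ℕ, ∑ d ∈ p.support,
      φ (MvPolynomial.C (p.coeff d)) * φ (MvPolynomial.monomial d 1) ^ i = 0) :
    p ∈ Ideal.span {q : DPoly K n | ∃ d d', φ (MvPolynomial.monomial d 1) =
      φ (MvPolynomial.monomial d' 1) ∧ q = binom K d d'} := by
  classical
  have key : ∀ t : E, ∑ d ∈ p.support with φ (MvPolynomial.monomial d 1) = t, p.coeff d = 0 := by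
    intro t
    by_cases ht : t ∈ p.support.image fun d => φ (MvPolynomial.monomial d 1)
    swap
    · refine Finset.sum_eq_zero fun d hd => absurd ?_ ht
      obtain ⟨hdp, rfl⟩ := Finset.mem_filter.1 hd
      exact Finset.mem_image.2 ⟨d, hdp, rfl⟩
    have hli := ((linearIndependent_monoidHom (Multiplicative ℕ) E).comp (powersHom E)
      (powersHom E).injective)
    have := linearIndependent_iff'.1 hli (p.support.image fun d => φ (MvPolynomial.monomial d 1))
      (fun t => ∑ d ∈ p.support with φ (MvPolynomial.monomial d 1) = t,
        φ (MvPolynomial.C (p.coeff d))) ?_ t ht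
    · rw [← map_sum, ← map_sum] at this
      exact (φ.comp MvPolynomial.C).injective (by simpa using this)
    · funext i
      have h := hp i.toAdd
      rw [← Finset.sum_fiberwise_of_maps_to
        (t := p.support.image fun d => φ (MvPolynomial.monomial d 1))
        (fun d hd => Finset.mem_image_of_mem _ hd)] at h
      rw [Finset.sum_apply, Pi.zero_apply, ← h]
      refine Finset.sum_congr rfl fun t _ => ?_
      rw [Pi.smul_apply, smul_eq_mul, Finset.sum_mul]
      refine Finset.sum_congr rfl fun d hd => ?_
      rw [(Finset.mem_filter.1 hd).2]
      simp
  exact mem_span_binom_of_fiber_sums (fun d => φ (MvPolynomial.monomial d 1)) p key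

theorem colonIdeal_le_span_binom {σK : K →+* K} {S : Set (DPoly K n)} {E : Type*} [CommRing E]
    [IsDomain E] (φ : DPoly K n →+* E) (τ : E →+* E) (hφ : ∀ p, φ (shift σK p) = τ (φ p))
    (hX : ∀ v, φ (MvPolynomial.X v) ≠ 0)
    (hS : ∀ p ∈ S, ∃ d d', φ (MvPolynomial.monomial d 1) = φ (MvPolynomial.monomial d' 1) ∧
      p = binom K d d') :
    colonIdeal (rwmClosure (shift σK) (sigmaIdealGen (shift σK) S : Set (DPoly K n))) ≤
      Ideal.span {q : DPoly K n | ∃ d d', φ (MvPolynomial.monomial d 1) =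
        φ (MvPolynomial.monomial d' 1) ∧ q = binom K d d'} := by
  intro p hp
  refine mem_span_binom_of_power_sums φ p fun i => ?_
  let Φ : DPoly K n →+* E :=
    MvPolynomial.eval₂Hom (φ.comp MvPolynomial.C) fun v => φ (MvPolynomial.X v) ^ i
  have hmon : ∀ d c, Φ (MvPolynomial.monomial d c) =
      φ (MvPolynomial.C c) * φ (MvPolynomial.monomial d 1) ^ i := by
    intro d c
    simp only [Φ, MvPolynomial.coe_eval₂Hom, MvPolynomial.eval₂_monomial, RingHom.comp_apply]
    congr 1
    rw [MvPolynomial.monomial_eq, map_one, one_mul, map_finsuppProd, Finsupp.prod, Finsupp.prod,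
      ← Finset.prod_pow]
    refine Finset.prod_congr rfl fun v _ => ?_
    rw [map_pow, ← pow_mul, ← pow_mul, mul_comm]
  have hΦτ : Φ.comp (shift σK) = τ.comp Φ := by
    refine MvPolynomial.ringHom_ext (fun c => ?_) fun v => ?_
    · have := hφ (MvPolynomial.C c)
      simpa [Φ, shift] using this
    · have := hφ (MvPolynomial.X v)
      simp only [shift, MvPolynomial.coe_eval₂Hom, MvPolynomial.eval₂_X] at this
      simp [Φ, shift, this]
  have hσ : IsSigmaIdeal (shift σK) (RingHom.ker Φ) := by
    intro a ha
    rw [RingHom.mem_ker] at ha ⊢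
    have := congrArg (fun f => f a) hΦτ
    simp only [RingHom.comp_apply] at this
    rw [this, ha, map_zero]
  have hprime : (RingHom.ker Φ).IsPrime := RingHom.ker_isPrime Φ
  have hSker : S ⊆ RingHom.ker Φ := by
    intro s hs
    obtain ⟨d, d', hdd, rfl⟩ := hS s hs
    rw [SetLike.mem_coe, RingHom.mem_ker, binom, map_sub, hmon, hmon, hdd, sub_self]
  have hle := colonIdeal_le (rwmClosure_le (sigmaIdealGen_le hSker hσ) hσ
    (hσ.isWellMixed_of_isPrime hprime) hprime.isRadical) hprime (fun v hv => by
      rw [RingHom.mem_ker] at hv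
      simp only [Φ, MvPolynomial.coe_eval₂Hom, MvPolynomial.eval₂_X] at hv
      exact hX v (eq_zero_of_pow_eq_zero hv)) hp
  rw [RingHom.mem_ker, p.as_sum, map_sum] at hle
  simpa only [hmon] using hle

end BinomialSpans

section TorsionFree

theorem TwoUniqueSums.of_isAddTorsionFree (M : Type*) [AddCommGroup M] [IsAddTorsionFree M] :
    TwoUniqueSums M := by
  let f : M →ₗ[ℤ] TensorProduct ℤ ℚ M :=
    (LinearMap.rTensor M (Algebra.linearMap ℤ ℚ)).comp (TensorProduct.lid ℤ M).symm.toLinearMap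
  have hf : Function.Injective f :=
    (Module.Flat.rTensor_preserves_injective_linearMap (M := M) (Algebra.linearMap ℤ ℚ)
      Rat.intCast_injective).comp (TensorProduct.lid ℤ M).symm.injective
  exact TwoUniqueSums.of_injective_addHom ⟨f, map_add f⟩ hf inferInstance

end TorsionFree

section PrimeLattice

variable {K : Type*} [Field K] {n : ℕ} {σK : K →+* K}

theorem monomial_notMem {Q : Ideal (DPoly K n)} (hQ : Q.IsPrime)
    (hX : ∀ v, (MvPolynomial.X v : DPoly K n) ∉ Q) (d : (Fin n × ℕ) →₀ ℕ) :
    (MvPolynomial.monomial d 1 : DPoly K n) ∉ Q := by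
  rw [monomial_mem_iff hQ]
  rintro ⟨v, -, hv⟩
  exact hX v hv

/-- The lattice of exponent differences of binomials in a σ-ideal. -/
def binomLattice {Q : Ideal (DPoly K n)} (hσ : IsSigmaIdeal (shift σK) Q) :
    Submodule ℤ[X] (Fin n → ℤ[X]) :=
  let A : AddSubgroup (Fin n → ℤ[X]) :=
    { carrier := {h | ∃ d d', expVec d - expVec d' = h ∧ binom K d d' ∈ Q}
      zero_mem' := ⟨0, 0, by simp, by simp [binom]⟩
      add_mem' := by
        rintro _ _ ⟨p, q, rfl, hb⟩ ⟨p', q', rfl, hb'⟩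
        refine ⟨p + p', q + q', by rw [map_add, map_add]; abel, ?_⟩
        rw [binom_add]
        exact add_mem (Q.mul_mem_left _ hb) (Q.mul_mem_left _ hb')
      neg_mem' := by
        rintro _ ⟨p, q, rfl, hb⟩
        refine ⟨q, p, by abel, ?_⟩
        have := neg_mem hb
        simpa [binom] using this }
  { A with
    smul_mem' := by
      intro c h hh
      change c • h ∈ A
      have hX : ∀ h ∈ A, (X : ℤ[X]) • h ∈ A := by
        rintro _ ⟨p, q, rfl, hb⟩
        refine ⟨shiftExp p, shiftExp q, ?_, ?_⟩
        · rw [expVec_shiftExp, expVec_shiftExp, smul_sub]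
        · rw [← shift_binom σK]
          exact hσ _ hb
      have hXk : ∀ k : ℕ, (X : ℤ[X]) ^ k • h ∈ A := by
        intro k
        induction k with
        | zero => simpa using hh
        | succ k ih =>
          rw [pow_succ', mul_smul]
          exact hX _ ih
      induction c using Polynomial.induction_on' with
      | add p q hp hq =>
        rw [add_smul]
        exact add_mem hp hq
      | monomial k a =>
        rw [← C_mul_X_pow_eq_monomial, mul_smul, ← algebraMap_eq, algebraMap_smul]
        exact zsmul_mem (hXk k) a }

theorem mem_binomLattice {Q : Ideal (DPoly K n)} (hσ : IsSigmaIdeal (shift σK) Q)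
    {h : Fin n → ℤ[X]} :
    h ∈ binomLattice hσ ↔ ∃ d d', expVec d - expVec d' = h ∧ binom K d d' ∈ Q := Iff.rfl

theorem sub_mem_binomLattice {Q : Ideal (DPoly K n)} (hσ : IsSigmaIdeal (shift σK) Q)
    (hQ : Q.IsPrime) (hX : ∀ v, (MvPolynomial.X v : DPoly K n) ∉ Q) {d d' : (Fin n × ℕ) →₀ ℕ} :
    expVec d - expVec d' ∈ binomLattice hσ ↔ binom K d d' ∈ Q := by
  constructor
  · rintro ⟨p, q, he, hb⟩
    exact binom_mem_of_sub_eq hQ (monomial_notMem hQ hX q) he hb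
  · exact fun h => ⟨d, d', rfl, h⟩

/-- The span of the binomials with exponent difference in `L`. -/
noncomputable def binomSpan (K : Type*) [Field K] (L : Submodule ℤ[X] (Fin n → ℤ[X])) :
    Ideal (DPoly K n) :=
  Ideal.span {q | ∃ d d', expVec d - expVec d' ∈ L ∧ q = binom K d d'}

theorem binomSpan_le_iff {L : Submodule ℤ[X] (Fin n → ℤ[X])} {P : Ideal (DPoly K n)} :
    binomSpan K L ≤ P ↔ ∀ d d', expVec d - expVec d' ∈ L → binom K d d' ∈ P := by
  rw [binomSpan, Ideal.span_le]
  constructor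
  · exact fun h d d' hd => h ⟨d, d', hd, rfl⟩
  · rintro h _ ⟨d, d', hd, rfl⟩
    exact h d d' hd

/-- The generic point of a prime ideal, graded by a quotient of the exponent module. -/
noncomputable def gradedPoint (Q : Ideal (DPoly K n)) (Λ : Submodule ℤ[X] (Fin n → ℤ[X])) :
    DPoly K n →+* AddMonoidAlgebra (DPoly K n ⧸ Q) ((Fin n → ℤ[X]) ⧸ Λ) :=
  MvPolynomial.eval₂Hom
    (AddMonoidAlgebra.singleZeroRingHom.comp ((Ideal.Quotient.mk Q).comp MvPolynomial.C))
    fun v => AddMonoidAlgebra.single (Λ.mkQ (expVec (Finsupp.single v 1)))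
      (Ideal.Quotient.mk Q (MvPolynomial.X v))

theorem gradedPoint_monomial (Q : Ideal (DPoly K n)) (Λ : Submodule ℤ[X] (Fin n → ℤ[X]))
    (d : (Fin n × ℕ) →₀ ℕ) :
    gradedPoint Q Λ (MvPolynomial.monomial d 1) = AddMonoidAlgebra.single (Λ.mkQ (expVec d))
      (Ideal.Quotient.mk Q (MvPolynomial.monomial d 1)) := by
  induction d using Finsupp.induction_linear with
  | zero =>
    change gradedPoint Q Λ 1 = AddMonoidAlgebra.single (Λ.mkQ (expVec 0)) (Ideal.Quotient.mk Q 1)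
    rw [map_one, map_one, map_zero, map_zero, AddMonoidAlgebra.one_def]
  | add d d' h h' =>
    rw [monomial_add_one, map_mul, map_mul, map_add, map_add, h, h',
      AddMonoidAlgebra.single_mul_single]
  | single v c =>
    rw [← MvPolynomial.X_pow_eq_monomial, map_pow, map_pow, gradedPoint, MvPolynomial.coe_eval₂Hom,
      MvPolynomial.eval₂_X, AddMonoidAlgebra.single_pow, ← map_nsmul, ← map_nsmul]
    simp

/-- The difference operator on the target of `gradedPoint`. -/
noncomputable def gradedShift {Q : Ideal (DPoly K n)} (hσ : IsSigmaIdeal (shift σK) Q)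
    (Λ : Submodule ℤ[X] (Fin n → ℤ[X])) :
    AddMonoidAlgebra (DPoly K n ⧸ Q) ((Fin n → ℤ[X]) ⧸ Λ) →+*
      AddMonoidAlgebra (DPoly K n ⧸ Q) ((Fin n → ℤ[X]) ⧸ Λ) :=
  (AddMonoidAlgebra.mapRingHom _ (Ideal.quotientMap Q (shift σK) fun _ ha => hσ _ ha)).comp
    (AddMonoidAlgebra.mapDomainRingHom _
      (DistribSMul.toAddMonoidHom ((Fin n → ℤ[X]) ⧸ Λ) (X : ℤ[X])))

theorem gradedPoint_shift {Q : Ideal (DPoly K n)} (hσ : IsSigmaIdeal (shift σK) Q)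
    (Λ : Submodule ℤ[X] (Fin n → ℤ[X])) (p : DPoly K n) :
    gradedPoint Q Λ (shift σK p) = gradedShift hσ Λ (gradedPoint Q Λ p) := by
  have h : (gradedPoint Q Λ).comp (shift σK) = (gradedShift hσ Λ).comp (gradedPoint Q Λ) := by
    refine MvPolynomial.ringHom_ext (fun c => ?_) fun v => ?_
    · simp [gradedPoint, gradedShift, shift]
    · simp only [gradedPoint, gradedShift, shift, RingHom.comp_apply, MvPolynomial.coe_eval₂Hom,
        MvPolynomial.eval₂_X, AddMonoidAlgebra.mapDomainRingHom_apply,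
        AddMonoidAlgebra.mapDomain_single, AddMonoidAlgebra.mapRingHom_single,
        Ideal.quotientMap_mk, DistribSMul.toAddMonoidHom_apply, ← map_smul, ← expVec_shiftExp,
        shiftExp_single]
  exact RingHom.congr_fun h p

theorem gradedPoint_monomial_eq_iff {Q : Ideal (DPoly K n)} (hσ : IsSigmaIdeal (shift σK) Q)
    (hQ : Q.IsPrime) (hX : ∀ v, (MvPolynomial.X v : DPoly K n) ∉ Q)
    (Λ : Submodule ℤ[X] (Fin n → ℤ[X])) (d d' : (Fin n × ℕ) →₀ ℕ) :
    gradedPoint Q Λ (MvPolynomial.monomial d 1) = gradedPoint Q Λ (MvPolynomial.monomial d' 1) ↔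
      expVec d - expVec d' ∈ binomLattice hσ ⊓ Λ := by
  have hne : Ideal.Quotient.mk Q (MvPolynomial.monomial d 1) ≠ 0 := fun h =>
    monomial_notMem hQ hX d (Ideal.Quotient.eq_zero_iff_mem.1 h)
  rw [gradedPoint_monomial, gradedPoint_monomial, Submodule.mem_inf, sub_mem_binomLattice hσ hQ hX,
    ← Submodule.Quotient.eq, binom, ← Ideal.Quotient.eq, ← AddMonoidAlgebra.coeff_inj,
    AddMonoidAlgebra.coeff_single, AddMonoidAlgebra.coeff_single, Finsupp.single_eq_single_iff]
  constructor
  · rintro (⟨h1, h2⟩ | ⟨h1, -⟩)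
    · exact ⟨h2, h1⟩
    · exact absurd h1 hne
  · rintro ⟨h1, h2⟩
    exact Or.inl ⟨h2, h1⟩

theorem colonIdeal_le_binomSpan {Q : Ideal (DPoly K n)} (hσ : IsSigmaIdeal (shift σK) Q)
    (hQ : Q.IsPrime) (hX : ∀ v, (MvPolynomial.X v : DPoly K n) ∉ Q)
    (Λ : Submodule ℤ[X] (Fin n → ℤ[X])) [IsAddTorsionFree ((Fin n → ℤ[X]) ⧸ Λ)]
    {S : Set (DPoly K n)}
    (hS : ∀ p ∈ S, p ∈ Q ∧ ∃ d d', expVec d - expVec d' ∈ Λ ∧ p = binom K d d') :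
    colonIdeal (rwmClosure (shift σK) (sigmaIdealGen (shift σK) S : Set (DPoly K n))) ≤
      binomSpan K (binomLattice hσ ⊓ Λ) := by
  have : TwoUniqueSums ((Fin n → ℤ[X]) ⧸ Λ) := TwoUniqueSums.of_isAddTorsionFree _
  have : IsDomain (AddMonoidAlgebra (DPoly K n ⧸ Q) ((Fin n → ℤ[X]) ⧸ Λ)) := inferInstance
  refine (colonIdeal_le_span_binom (σK := σK)
    (E := AddMonoidAlgebra (DPoly K n ⧸ Q) ((Fin n → ℤ[X]) ⧸ Λ)) (gradedPoint Q Λ)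
    (gradedShift hσ Λ) (gradedPoint_shift hσ Λ)
    (fun v => ?_) fun p hp => ?_).trans (le_of_eq ?_)
  · rw [← pow_one (MvPolynomial.X v), MvPolynomial.X_pow_eq_monomial, gradedPoint_monomial]
    intro h
    rw [AddMonoidAlgebra.single_eq_zero] at h
    exact monomial_notMem hQ hX _ (Ideal.Quotient.eq_zero_iff_mem.1 h)
  · obtain ⟨hpQ, d, d', hd, rfl⟩ := hS p hp
    exact ⟨d, d', (gradedPoint_monomial_eq_iff hσ hQ hX Λ d d').2
      ⟨(sub_mem_binomLattice hσ hQ hX).2 hpQ, hd⟩, rfl⟩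
  · simp only [gradedPoint_monomial_eq_iff hσ hQ hX, binomSpan]

end PrimeLattice

section Saturation

variable {R M : Type*} [CommRing R] [AddCommGroup M] [Module R M]

theorem Submodule.exists_torsionFree_quotient [IsNoetherian R M] (L : Submodule R M) :
    ∃ (Λ : Submodule R M) (e : ℕ), 0 < e ∧ L ≤ Λ ∧ (∀ h ∈ Λ, e • h ∈ L) ∧
      IsAddTorsionFree (M ⧸ Λ) := by
  let f : ℕ →o Submodule R M :=
    { toFun := fun k => L.comap (k.factorial • LinearMap.id)
      monotone' := by
        intro k l hkl h hh
        obtain ⟨c, hc⟩ := Nat.factorial_dvd_factorial hkl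
        change l.factorial • h ∈ L
        rw [hc, mul_comm, mul_smul]
        exact L.smul_of_tower_mem c hh }
  have hf : ∀ k h, h ∈ f k ↔ k.factorial • h ∈ L := fun _ _ => Iff.rfl
  obtain ⟨N, hN⟩ := monotone_stabilizes_iff_noetherian.2 ‹IsNoetherian R M› f
  refine ⟨f N, N.factorial, N.factorial_pos, fun h hh => (hf _ _).2 (L.smul_of_tower_mem _ hh),
    fun _ hh => hh,
    ⟨fun k hk x y hxy => ?_⟩⟩
  obtain ⟨x, rfl⟩ := Submodule.Quotient.mk_surjective _ x
  obtain ⟨y, rfl⟩ := Submodule.Quotient.mk_surjective _ y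
  change k • Submodule.Quotient.mk x = k • Submodule.Quotient.mk y at hxy
  rw [← Submodule.Quotient.mk_smul, ← Submodule.Quotient.mk_smul, Submodule.Quotient.eq,
    ← smul_sub] at hxy
  rw [Submodule.Quotient.eq, hN (N + k) (Nat.le_add_right _ _), hf]
  obtain ⟨c, hc⟩ := (mul_dvd_mul_left N.factorial (Nat.dvd_factorial (Nat.pos_of_ne_zero hk)
    le_rfl)).trans (Nat.factorial_mul_factorial_dvd_factorial_add N k)
  rw [hc, mul_comm, mul_smul, mul_smul]
  exact L.smul_of_tower_mem c hxy

end Saturation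
section Cyclic

theorem exists_zsmul_sub_mem_ker {M F : Type*} [AddCommGroup M] [Field F]
    (χ : Multiplicative M →* Fˣ) (Λ : AddSubgroup M) {e : ℕ} (he : 0 < e)
    (h : ∀ x ∈ Λ, χ (.ofAdd (e • x)) = 1) :
    ∃ x₀ ∈ Λ, ∀ x ∈ Λ, ∃ k : ℤ, χ (.ofAdd (x - k • x₀)) = 1 := by
  let H : Subgroup Fˣ := (AddSubgroup.toSubgroup Λ).map χ
  have : NeZero e := ⟨he.ne'⟩
  have hH : H ≤ rootsOfUnity e F := by
    rintro _ ⟨x, hx, rfl⟩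
    rw [mem_rootsOfUnity, ← map_pow]
    exact h _ hx
  have : Finite H := Finite.of_injective _ (Subgroup.inclusion_injective hH)
  obtain ⟨⟨_, x₀, hx₀, rfl⟩, hg⟩ := (isCyclic_subgroup_units H).exists_generator
  refine ⟨x₀.toAdd, hx₀, fun x hx => ?_⟩
  obtain ⟨k, hk⟩ := Subgroup.mem_zpowers_iff.1 (hg ⟨χ (.ofAdd x), .ofAdd x, hx, rfl⟩)
  refine ⟨k, ?_⟩
  have hk' : χ x₀ ^ k = χ (.ofAdd x) := congrArg Subtype.val hk
  rw [ofAdd_sub, ofAdd_zsmul, ofAdd_toAdd, _root_.map_div, map_zpow, hk', div_self']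

variable {K : Type*} [Field K] {n : ℕ} {σK : K →+* K}

theorem exists_character {Q : Ideal (DPoly K n)} (hσ : IsSigmaIdeal (shift σK) Q)
    (hQ : Q.IsPrime) (hX : ∀ v, (MvPolynomial.X v : DPoly K n) ∉ Q) :
    ∃ χ : Multiplicative (Fin n → ℤ[X]) →* (FractionRing (DPoly K n ⧸ Q))ˣ,
      ∀ h, χ (.ofAdd h) = 1 ↔ h ∈ binomLattice hσ := by
  let π : DPoly K n →+* FractionRing (DPoly K n ⧸ Q) :=
    (algebraMap (DPoly K n ⧸ Q) (FractionRing (DPoly K n ⧸ Q))).comp (Ideal.Quotient.mk Q)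
  have hπ : ∀ p, π p = 0 ↔ p ∈ Q := fun p => by
    rw [← Ideal.Quotient.eq_zero_iff_mem]
    exact map_eq_zero_iff _ (IsFractionRing.injective (DPoly K n ⧸ Q) _)
  let u : ((Fin n × ℕ) →₀ ℕ) → (FractionRing (DPoly K n ⧸ Q))ˣ := fun d =>
    Units.mk0 (π (MvPolynomial.monomial d 1)) fun h => monomial_notMem hQ hX d ((hπ _).1 h)
  have hu : ∀ d d', u (d + d') = u d * u d' := fun d d' => Units.ext <| by
    change π _ = π _ * π _
    rw [monomial_add_one, map_mul]
  have key : ∀ d d' q q', expVec d - expVec d' = expVec q - expVec q' →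
      u d / u d' = u q / u q' := fun d d' q q' h => by
    rw [div_eq_div_iff_mul_eq_mul, ← hu, ← hu]
    congr 1
    apply expVec_injective
    rw [map_add, map_add]
    rwa [sub_eq_sub_iff_add_eq_add] at h
  let χ : Multiplicative (Fin n → ℤ[X]) →* (FractionRing (DPoly K n ⧸ Q))ˣ :=
    MonoidHom.mk' (fun h => u (posExp h.toAdd) / u (posExp (-h.toAdd))) fun a b => by
      rw [div_mul_div_comm, ← hu, ← hu]
      apply key
      rw [expVec_posExp_sub, map_add, map_add, add_sub_add_comm, expVec_posExp_sub,
        expVec_posExp_sub, toAdd_mul]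
  refine ⟨χ, fun h => ?_⟩
  rw [← expVec_posExp_sub h, sub_mem_binomLattice hσ hQ hX, ← hπ, expVec_posExp_sub h]
  change u (posExp h) / u (posExp (-h)) = 1 ↔ _
  rw [div_eq_one, ← Units.val_inj, binom, map_sub, sub_eq_zero]
  rfl

theorem exists_X_sub_C_smul_mem_binomLattice {Q : Ideal (DPoly K n)}
    (hσ : IsSigmaIdeal (shift σK) Q) (hQ : Q.IsPrime)
    (hX : ∀ v, (MvPolynomial.X v : DPoly K n) ∉ Q) (Λ : Submodule ℤ[X] (Fin n → ℤ[X]))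
    {e : ℕ} (he : 0 < e) (hΛ : ∀ h ∈ Λ, e • h ∈ binomLattice hσ) :
    ∃ s < e, ∀ h ∈ Λ, (X - C (s : ℤ)) • h ∈ binomLattice hσ := by
  obtain ⟨χ, hχ⟩ := exists_character hσ hQ hX
  obtain ⟨x₀, hx₀, hk⟩ := exists_zsmul_sub_mem_ker χ Λ.toAddSubgroup he
    fun x hx => (hχ _).2 (hΛ x hx)
  simp only [hχ] at hk
  obtain ⟨s, hs⟩ := hk _ (Λ.smul_mem (X : ℤ[X]) hx₀)
  have he' : (e : ℤ) ≠ 0 := by exact_mod_cast he.ne'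
  refine ⟨(s % e).toNat, ?_, fun h hh => ?_⟩
  · have := Int.emod_lt_of_pos s (Int.natCast_pos.2 he)
    have := Int.emod_nonneg s he'
    omega
  obtain ⟨k, hk⟩ := hk h hh
  rw [Int.toNat_of_nonneg (Int.emod_nonneg s he')]
  have h1 : (X - C (s % e)) • x₀ ∈ binomLattice hσ := by
    have : (X - C (s % e)) • x₀ = ((X : ℤ[X]) • x₀ - s • x₀) + (s / e) • (e • x₀) := by
      have hsplit : s • x₀ = (s % e) • x₀ + (s / e * e) • x₀ := by
        rw [← add_smul, mul_comm, Int.emod_add_mul_ediv]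
      rw [sub_smul, ← natCast_zsmul x₀ e, ← mul_smul, hsplit, ← algebraMap_eq, algebraMap_smul]
      abel
    rw [this]
    exact add_mem hs ((binomLattice hσ).smul_of_tower_mem _ (hΛ _ hx₀))
  have h2 : (X - C (s % e)) • h =
      (X - C (s % e)) • (h - k • x₀) + k • ((X - C (s % e)) • x₀) := by
    rw [smul_sub, smul_comm k]
    abel
  rw [h2]
  exact add_mem ((binomLattice hσ).smul_mem _ hk) ((binomLattice hσ).smul_of_tower_mem _ h1)

end Cyclic

section Finiteness

theorem finite_setOf_X_sub_C_smul_mem {M : Type*} [AddCommGroup M] [Module ℤ[X] M]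
    {Λ : Submodule ℤ[X] M} (hΛ : Λ.FG) {e : ℕ} (he : 0 < e) (s : ℤ) :
    {L : Submodule ℤ[X] M | L ≤ Λ ∧ (∀ h ∈ Λ, e • h ∈ L) ∧
      ∀ h ∈ Λ, (X - C s) • h ∈ L}.Finite := by
  obtain ⟨m, b, rfl⟩ := Submodule.fg_iff_exists_fin_generating_family.1 hΛ
  have hb : ∀ i, b i ∈ Submodule.span ℤ[X] (Set.range b) := fun i =>
    Submodule.subset_span ⟨i, rfl⟩
  have he' : (e : ℤ) ≠ 0 := by exact_mod_cast he.ne'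
  refine Set.Finite.of_finite_image
    (f := fun L => {c : Fin m → Fin e | ∑ i, (c i : ℕ) • b i ∈ L}) (Set.toFinite _) ?_
  have red : ∀ h ∈ Submodule.span ℤ[X] (Set.range b), ∃ c : Fin m → Fin e,
      ∀ L : Submodule ℤ[X] M, (∀ h ∈ Submodule.span ℤ[X] (Set.range b), e • h ∈ L) →
        (∀ h ∈ Submodule.span ℤ[X] (Set.range b), (X - C s) • h ∈ L) →
        (h ∈ L ↔ ∑ i, (c i : ℕ) • b i ∈ L) := by
    intro h hh
    obtain ⟨p, rfl⟩ := (Submodule.mem_span_range_iff_exists_fun _).1 hh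
    have hc : ∀ i, ∃ (c : Fin e) (q : ℤ[X]) (r : ℤ),
        p i = (X - C s) * q + C (e * r) + C ((c : ℕ) : ℤ) := by
      intro i
      refine ⟨⟨((p i).eval s % e).toNat, ?_⟩, p i /ₘ (X - C s), (p i).eval s / e, ?_⟩
      · have := Int.emod_lt_of_pos ((p i).eval s) (Int.natCast_pos.2 he)
        have := Int.emod_nonneg ((p i).eval s) he'
        omega
      · rw [Int.toNat_of_nonneg (Int.emod_nonneg _ he'), add_assoc, ← C_add,
          Int.mul_ediv_add_emod, add_comm, ← modByMonic_X_sub_C_eq_C_eval,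
          modByMonic_add_div]
    choose c q r hp using hc
    refine ⟨c, fun L h1 h2 => ?_⟩
    have hd : ∑ i, p i • b i - ∑ i, (c i : ℕ) • b i ∈ L := by
      rw [← Finset.sum_sub_distrib]
      refine sum_mem fun i _ => ?_
      have : p i • b i - (c i : ℕ) • b i = (X - C s) • (q i • b i) + e • (r i • b i) := by
        rw [hp i, add_smul, add_smul, mul_smul, ← algebraMap_eq, algebraMap_smul, algebraMap_smul,
          mul_smul, natCast_zsmul, natCast_zsmul]
        abel
      rw [this]
      exact add_mem (h2 _ (Submodule.smul_mem _ _ (hb i)))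
        (h1 _ (Submodule.smul_of_tower_mem _ _ (hb i)))
    exact ⟨fun h => by simpa using sub_mem h hd, fun h => by simpa using add_mem hd h⟩
  have le : ∀ L₁ L₂ : Submodule ℤ[X] M, L₁ ≤ Submodule.span ℤ[X] (Set.range b) →
      (∀ h ∈ Submodule.span ℤ[X] (Set.range b), e • h ∈ L₁) →
      (∀ h ∈ Submodule.span ℤ[X] (Set.range b), (X - C s) • h ∈ L₁) →
      (∀ h ∈ Submodule.span ℤ[X] (Set.range b), e • h ∈ L₂) →
      (∀ h ∈ Submodule.span ℤ[X] (Set.range b), (X - C s) • h ∈ L₂) →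
      {c : Fin m → Fin e | ∑ i, (c i : ℕ) • b i ∈ L₁} =
        {c : Fin m → Fin e | ∑ i, (c i : ℕ) • b i ∈ L₂} → L₁ ≤ L₂ := by
    intro L₁ L₂ h₁ h₂ h₃ h₄ h₅ heq h hh
    obtain ⟨c, hc⟩ := red h (h₁ hh)
    exact (hc L₂ h₄ h₅).2 ((Set.ext_iff.1 heq c).1 ((hc L₁ h₂ h₃).1 hh))
  rintro L₁ ⟨h₁, h₂, h₃⟩ L₂ ⟨k₁, k₂, k₃⟩ heq
  exact le_antisymm (le L₁ L₂ h₁ h₂ h₃ k₂ k₃ heq) (le L₂ L₁ k₁ k₂ k₃ h₂ h₃ heq.symm)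

end Finiteness

section Monomials

variable {K : Type*} [Field K] {n : ℕ}

theorem exists_monom_eq_monomial (σK : K →+* K) (f : Fin n → ℕ[X]) :
    ∃ d, (monom σK f : DPoly K n) = MvPolynomial.monomial d 1 := by
  let N : Submonoid (DPoly K n) :=
    { carrier := {q | ∃ d, q = MvPolynomial.monomial d 1}
      one_mem' := ⟨0, rfl⟩
      mul_mem' := by
        rintro _ _ ⟨d, rfl⟩ ⟨d', rfl⟩
        exact ⟨d + d', (monomial_add_one d d').symm⟩ }
  have hN : ∀ d, (MvPolynomial.monomial d 1 : DPoly K n) ∈ N := fun d => ⟨d, rfl⟩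
  have hit : ∀ (k : ℕ) (d : (Fin n × ℕ) →₀ ℕ),
      (⇑(shift σK))^[k] (MvPolynomial.monomial d 1 : DPoly K n) ∈ N := by
    intro k
    induction k with
    | zero => exact hN
    | succ k ih =>
      intro d
      rw [Function.iterate_succ_apply, shift_monomial, map_one]
      exact ih _
  change monom σK f ∈ N
  refine N.prod_mem fun i _ => ?_
  rw [ypow, sexp]
  refine N.prod_mem fun j _ => N.pow_mem ?_ _
  rw [← pow_one (MvPolynomial.X (i, 0)), MvPolynomial.X_pow_eq_monomial]
  exact hit _ _

theorem exists_eq_binom {σK : K →+* K} {p : DPoly K n} (hp : IsPureBinomial σK p) :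
    ∃ d d', p = binom K d d' := by
  obtain ⟨f, g, rfl⟩ := hp
  obtain ⟨d, hd⟩ := exists_monom_eq_monomial σK f
  obtain ⟨d', hd'⟩ := exists_monom_eq_monomial σK g
  exact ⟨d, d', by rw [hd, hd', binom]⟩

end Monomials

section FiniteGeneration

variable {K : Type*} [Field K] {n : ℕ} {σK : K →+* K}

theorem exists_finite_lattices {S : Set (DPoly K n)} (hS : ∀ p ∈ S, ∃ d d', p = binom K d d') :
    ∃ 𝒮 : Finset (Submodule ℤ[X] (Fin n → ℤ[X])),
      (∀ L ∈ 𝒮, colonIdeal (rwmClosure (shift σK)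
        (sigmaIdealGen (shift σK) S : Set (DPoly K n))) ≤ binomSpan K L) ∧
      ∀ Q : Ideal (DPoly K n), Q.IsPrime → IsSigmaIdeal (shift σK) Q →
        (∀ v, (MvPolynomial.X v : DPoly K n) ∉ Q) → S ⊆ Q → ∃ L ∈ 𝒮, binomSpan K L ≤ Q := by
  classical
  let L := Submodule.span ℤ[X] {h : Fin n → ℤ[X] | ∃ d d', expVec d - expVec d' = h ∧
    binom K d d' ∈ S}
  obtain ⟨Λ, e, he, hLΛ, heΛ, htf⟩ := L.exists_torsionFree_quotient
  have hfin : (⋃ s ∈ Finset.range e, {L' : Submodule ℤ[X] (Fin n → ℤ[X]) | L' ≤ Λ ∧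
      (∀ h ∈ Λ, e • h ∈ L') ∧ ∀ h ∈ Λ, (X - C (s : ℤ)) • h ∈ L'}).Finite :=
    (Finset.range e).finite_toSet.biUnion fun s _ =>
      finite_setOf_X_sub_C_smul_mem (IsNoetherian.noetherian Λ) he s
  refine ⟨hfin.toFinset.filter fun L' => colonIdeal (rwmClosure (shift σK)
    (sigmaIdealGen (shift σK) S : Set (DPoly K n))) ≤ binomSpan K L',
    fun L' hL' => (Finset.mem_filter.1 hL').2,
    fun Q hQ hσ hX hSQ => ⟨binomLattice hσ ⊓ Λ, Finset.mem_filter.2 ⟨?_, ?_⟩,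
      binomSpan_le_iff.2 fun d d' hd => (sub_mem_binomLattice hσ hQ hX).1 hd.1⟩⟩
  · have hL : L ≤ binomLattice hσ := by
      refine Submodule.span_le.2 ?_
      rintro _ ⟨d, d', rfl, hb⟩
      exact ⟨d, d', rfl, hSQ hb⟩
    have heQ : ∀ h ∈ Λ, e • h ∈ binomLattice hσ := fun h hh => hL (heΛ h hh)
    obtain ⟨s, hs, hsΛ⟩ := exists_X_sub_C_smul_mem_binomLattice hσ hQ hX Λ he heQ
    rw [Set.Finite.mem_toFinset]
    simp only [Set.mem_iUnion]
    exact ⟨s, Finset.mem_range.2 hs, inf_le_right,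
      fun h hh => ⟨heQ h hh, Λ.smul_of_tower_mem e hh⟩,
      fun h hh => ⟨hsΛ h hh, Λ.smul_mem _ hh⟩⟩
  · refine colonIdeal_le_binomSpan hσ hQ hX Λ fun p hp => ⟨hSQ hp, ?_⟩
    obtain ⟨d, d', rfl⟩ := hS p hp
    exact ⟨d, d', hLΛ (Submodule.subset_span ⟨d, d', rfl, hp⟩), rfl⟩

theorem exists_finite_colonIdeal_eq_rwmClosure {S : Set (DPoly K n)}
    (hS : ∀ p ∈ S, ∃ d d', p = binom K d d') :
    ∃ G : Set (DPoly K n), G.Finite ∧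
      colonIdeal (rwmClosure (shift σK) (sigmaIdealGen (shift σK) S : Set (DPoly K n))) =
        rwmClosure (shift σK) G := by
  classical
  obtain ⟨𝒮, hle𝒮, h𝒮⟩ := exists_finite_lattices (σK := σK) hS
  set A := rwmClosure (shift σK) (sigmaIdealGen (shift σK) S : Set (DPoly K n)) with hA
  have hAr : A.IsRadical := isRadical_rwmClosure _
  have hJσ := isSigmaIdeal_colonIdeal (isSigmaIdeal_rwmClosure (σ := shift σK)
    (sigmaIdealGen (shift σK) S : Set (DPoly K n)))
  have hJw := isWellMixed_colonIdeal (isWellMixed_rwmClosure (σ := shift σK)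
    (sigmaIdealGen (shift σK) S : Set (DPoly K n)))
  have hJr := isRadical_colonIdeal hAr
  rw [← hA] at hJσ hJw
  have hSJ : S ⊆ colonIdeal A := fun p hp => ⟨1, Submonoid.one_mem _, by
    rw [one_mul]
    exact subset_rwmClosure _ (Submodule.mem_sInf.2 fun _ hJ => hJ.1 hp)⟩
  choose B hBL hB using fun L => exists_finset_binom_mem_prime (n := n) σK L
  let b : (Fin n → ℤ[X]) → DPoly K n := fun g => binom K (posExp g) (posExp (-g))
  let 𝔞 : Ideal (DPoly K n) := ∏ L ∈ 𝒮, Ideal.span ((B L).image b : Set (DPoly K n))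
  have h𝔞 : 𝔞.FG := by
    refine Finset.prod_induction _ Ideal.FG (fun _ _ => Ideal.FG.mul) ⟨{1}, by simp⟩
      fun L _ => ⟨_, rfl⟩
  obtain ⟨G, hG⟩ := h𝔞
  refine ⟨G, G.finite_toSet, le_antisymm ?_ (rwmClosure_le ?_ hJσ hJw hJr)⟩
  · rw [← (isRadical_rwmClosure (σ := shift σK) (G : Set (DPoly K n))).radical,
      ← Ideal.sInf_minimalPrimes]
    refine le_sInf fun P hP => ?_
    have hPp : P.IsPrime := hP.1.1
    have hPσ := isSigmaIdeal_of_mem_minimalPrimes (isWellMixed_rwmClosure _)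
      (isRadical_rwmClosure _) hP
    have : 𝔞 ≤ P := by
      rw [← hG, Ideal.span_le]
      exact (subset_rwmClosure _).trans hP.1.2
    obtain ⟨L, hL, hLP⟩ := hPp.prod_le.1 this
    refine (hle𝒮 L hL).trans (binomSpan_le_iff.2 (hB L P hPp hPσ fun g hg => hLP ?_))
    exact Ideal.subset_span (Finset.mem_coe.2 (Finset.mem_image_of_mem b hg))
  · have hle : 𝔞 ≤ colonIdeal A := by
      rw [← hJr.radical, ← Ideal.sInf_minimalPrimes]
      refine le_sInf fun Q hQ => ?_
      obtain ⟨L, hL, hLQ⟩ := h𝒮 Q hQ.1.1 (isSigmaIdeal_of_mem_minimalPrimes hJw hJr hQ)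
        (X_notMem_of_mem_minimalPrimes_colonIdeal hAr hQ) (hSJ.trans hQ.1.2)
      refine (hQ.1.1.prod_le.2 ⟨L, hL, ?_⟩)
      rw [Ideal.span_le, Finset.coe_image]
      rintro _ ⟨g, hg, rfl⟩
      refine binomSpan_le_iff.1 hLQ _ _ ?_
      rw [expVec_posExp_sub]
      exact hBL L hg
    rw [← hG, Ideal.span_le] at hle
    exact hle

end FiniteGeneration

/-- For a pure binomial σ-ideal `I`, `⟨I⟩_r : 𝔪` is a radical well-mixed σ-ideal
which is finitely generated as a radical well-mixed σ-ideal. -/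
theorem stmt3 {K : Type*} [Field K] [CharZero K] {n : ℕ} (σK : K →+* K)
    (I : Ideal (DPoly K n)) (hI : IsPureBinomialSigmaIdeal σK I) :
    ∃ J : Ideal (DPoly K n),
      (J : Set (DPoly K n)) = colonM (rwmClosure (shift σK) (I : Set (DPoly K n))) ∧
      IsSigmaIdeal (shift σK) J ∧ IsWellMixed (shift σK) J ∧ J.IsRadical ∧
      ∃ G : Set (DPoly K n), G.Finite ∧ G ⊆ (J : Set (DPoly K n)) ∧
        J = rwmClosure (shift σK) G := by
  obtain ⟨S, hS, rfl⟩ := hI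
  obtain ⟨G, hG, hJ⟩ :=
    exists_finite_colonIdeal_eq_rwmClosure (σK := σK) fun p hp => exists_eq_binom (hS p hp)
  exact ⟨_, rfl, isSigmaIdeal_colonIdeal (isSigmaIdeal_rwmClosure _),
    isWellMixed_colonIdeal (isWellMixed_rwmClosure _),
    isRadical_colonIdeal (isRadical_rwmClosure _), G, hG,
    by rw [hJ]; exact subset_rwmClosure G, hJ⟩
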